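/- arXiv:2207.09277 — 11 statements merged into one kernel-verified Lean document; each statement's English description precedes it below -/
import Mathlib

section
/- Let q be a prime power and let n, k, δ, α be positive integers with 1 ≤ k < n, α ≥ 2 and δ ≤ (α−1)k. Set h = ⌊k + 1 − δ/(α−1)⌋. Then every α-(n,k,δ)_q^c covering Grassmannian code C satisfies |C| · [k choose h]_q ≤ (α−1) · [n choose h]_q; in particular B_q(n,k,δ;α) ≤ (α−1)·[n choose h]_q / [k choose h]_q. -/
open Module

/-- The Gaussian binomial coefficient `[n choose m]_q`, as a rational number:
`∏_{i=0}^{m-1} (q^n - q^i)/(q^m - q^i)`. -/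
def gaussBinom (q n m : ℕ) : ℚ :=
  ∏ i ∈ Finset.range m, ((q : ℚ) ^ n - (q : ℚ) ^ i) / ((q : ℚ) ^ m - (q : ℚ) ^ i)

/-- `C` is an `α`-`(n, k, δ)_q^c` covering Grassmannian code over `F` (where `|F| = q`):
a set of `k`-dimensional subspaces of `F^n` such that any `α` distinct members
span a subspace of dimension at least `k + δ`. -/
def IsCoveringCode (F : Type) [Field F] (n k δ α : ℕ)
    (C : Finset (Submodule F (Fin n → F))) : Prop :=
  (∀ U ∈ C, finrank F ↥U = k) ∧
  ∀ S : Finset (Submodule F (Fin n → F)), S ⊆ C → S.card = α →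
    k + δ ≤ finrank F ↥(S.sup id)

/-- The number of codewords of `C` containing the subspace `W`. -/
noncomputable def containCount {F : Type} [Field F] {n : ℕ}
    (C : Finset (Submodule F (Fin n → F))) (W : Submodule F (Fin n → F)) : ℕ :=
  Nat.card {U : Submodule F (Fin n → F) // U ∈ C ∧ W ≤ U}

/-- `B_q(n, k, δ; α)`: the maximum cardinality of an `α`-`(n, k, δ)_q^c`
covering Grassmannian code over `F`. -/
noncomputable def maxCodeCard (F : Type) [Field F] (n k δ α : ℕ) : ℕ :=
  sSup {m : ℕ | ∃ C : Finset (Submodule F (Fin n → F)),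
    IsCoveringCode F n k δ α C ∧ C.card = m}


/-- If all members of a finite family of `k`-dimensional subspaces contain `W`, then together
with `W` they span a space of dimension at most `dim W + |S| (k - dim W)`. -/
theorem finrank_sup_id_add_le {F V : Type*} [Field F] [AddCommGroup V] [Module F V]
    [FiniteDimensional F V] (k : ℕ) (W : Submodule F V) (S : Finset (Submodule F V))
    (hS : ∀ U ∈ S, finrank F U = k ∧ W ≤ U) :
    finrank F ↥(S.sup id ⊔ W) + S.card * finrank F W ≤ finrank F W + S.card * k := by
  classical
  induction S using Finset.induction_on with
  | empty => rw [Finset.sup_empty, bot_sup_eq, Finset.card_empty, Nat.zero_mul, Nat.zero_mul]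
  | insert U S hU ih =>
    have ih := ih fun X hX => hS X (Finset.mem_insert_of_mem hX)
    obtain ⟨hUk, hWU⟩ := hS U (Finset.mem_insert_self U S)
    have hdim := Submodule.finrank_sup_add_finrank_inf_eq U (S.sup id ⊔ W)
    have hinf := Submodule.finrank_mono (le_inf hWU (le_sup_right : W ≤ S.sup id ⊔ W))
    rw [Finset.sup_insert, id, sup_assoc, Finset.card_insert_of_notMem hU]
    linarith

/-- The number of codewords containing a subspace `W` with `(α - 1) (k - dim W) < δ` is
less than `α`. -/
theorem IsCoveringCode.card_filter_lt {F : Type} [Field F] {n k δ α : ℕ}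
    {C : Finset (Submodule F (Fin n → F))} (hC : IsCoveringCode F n k δ α C)
    (W : Submodule F (Fin n → F)) [DecidablePred fun U => W ≤ U]
    (hW : finrank F W + α * k < α * finrank F W + k + δ) :
    (C.filter fun U => W ≤ U).card < α := by
  by_contra! hcard
  obtain ⟨S, hS, rfl⟩ := Finset.exists_subset_card_eq hcard
  have hspan := hC.2 S (hS.trans (Finset.filter_subset _ _)) rfl
  have hle := finrank_sup_id_add_le k W S fun U hU =>
    ⟨hC.1 U (Finset.mem_filter.1 (hS hU)).1, (Finset.mem_filter.1 (hS hU)).2⟩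
  have hmono := Submodule.finrank_mono (le_sup_left : S.sup id ≤ S.sup id ⊔ W)
  linarith

/-- The linearly independent `h`-tuples in a subspace `U`, counted as tuples of the ambient
space. -/
theorem card_linearIndependent_mem {F V : Type*} [Field F] [Fintype F] [AddCommGroup V]
    [Module F V] [FiniteDimensional F V] (U : Submodule F V) {h : ℕ} (hh : h ≤ finrank F U) :
    Nat.card {s : Fin h → V // LinearIndependent F s ∧ ∀ i, s i ∈ U} =
      ∏ i : Fin h, (Fintype.card F ^ finrank F U - Fintype.card F ^ (i : ℕ)) := by
  have : Finite V := Module.finite_of_finite F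
  have := Fintype.ofFinite U
  rw [← card_linearIndependent hh]
  refine Nat.card_congr
    { toFun := fun s => ⟨fun i => ⟨s.1 i, s.2.2 i⟩, LinearIndependent.of_comp U.subtype s.2.1⟩
      invFun := fun s => ⟨fun i => s.1 i,
        s.2.map' U.subtype U.ker_subtype, fun i => (s.1 i).2⟩
      left_inv := fun s => rfl
      right_inv := fun s => rfl }

theorem cast_prod_pow_sub_pow {q m h : ℕ} (hq : 1 ≤ q) (hhm : h ≤ m) :
    ((∏ i : Fin h, (q ^ m - q ^ (i : ℕ)) : ℕ) : ℚ) =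
      ∏ i ∈ Finset.range h, ((q : ℚ) ^ m - (q : ℚ) ^ i) := by
  rw [← Fin.prod_univ_eq_prod_range (fun i => (q : ℚ) ^ m - (q : ℚ) ^ i), Nat.cast_prod]
  refine Finset.prod_congr rfl fun i _ => ?_
  rw [Nat.cast_sub (Nat.pow_le_pow_right hq (i.2.le.trans hhm))]
  push_cast
  rfl

theorem prod_pow_sub_pow_pos {q m h : ℕ} (hq : 1 < q) (hhm : h ≤ m) :
    0 < ∏ i ∈ Finset.range h, ((q : ℚ) ^ m - (q : ℚ) ^ i) :=
  Finset.prod_pos fun _ hi => sub_pos.2 <|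
    pow_lt_pow_right₀ (by exact_mod_cast hq) ((Finset.mem_range.1 hi).trans_le hhm)

theorem gaussBinom_pos {q m h : ℕ} (hq : 1 < q) (hhm : h ≤ m) : 0 < gaussBinom q m h := by
  rw [gaussBinom, Finset.prod_div_distrib]
  exact div_pos (prod_pow_sub_pow_pos hq hhm) (prod_pow_sub_pow_pos hq le_rfl)

/-- Double counting of pairs of a codeword and a linearly independent `h`-tuple in it. -/
theorem IsCoveringCode.card_mul_prod_le {F : Type} [Field F] [Fintype F] {n k δ α h : ℕ}
    {C : Finset (Submodule F (Fin n → F))} (hC : IsCoveringCode F n k δ α C)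
    (hhk : h ≤ k) (hkn : k ≤ n) (hlt : h + α * k < α * h + k + δ) :
    C.card * ∏ i : Fin h, (Fintype.card F ^ k - Fintype.card F ^ (i : ℕ)) ≤
      (∏ i : Fin h, (Fintype.card F ^ n - Fintype.card F ^ (i : ℕ))) * (α - 1) := by
  classical
  let T : Finset (Fin h → Fin n → F) := Finset.univ.filter fun s => LinearIndependent F s
  have hT : T.card = ∏ i : Fin h, (Fintype.card F ^ n - Fintype.card F ^ (i : ℕ)) := by
    have hcount := card_linearIndependent (K := F) (V := Fin n → F) (k := h)
      (by simpa using hhk.trans hkn)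
    rw [finrank_fin_fun] at hcount
    rw [← hcount, Nat.card_eq_fintype_card, Fintype.card_subtype]
  rw [← hT]
  refine Finset.card_mul_le_card_mul (fun U s => ∀ i, s i ∈ U) (fun U hU => ?_)
    fun s hs => Nat.le_sub_one_of_lt ?_
  · have hcount := card_linearIndependent_mem U (hhk.trans (hC.1 U hU).ge)
    rw [hC.1 U hU, Nat.card_eq_fintype_card, Fintype.card_subtype] at hcount
    rw [← hcount, Finset.bipartiteAbove, Finset.filter_filter]
  · have hdim : finrank F (Submodule.span F (Set.range s)) = h := by
      rw [finrank_span_eq_card (Finset.mem_filter.1 hs).2, Fintype.card_fin]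
    have hfew := hC.card_filter_lt (Submodule.span F (Set.range s)) (by rwa [hdim])
    simp only [Submodule.span_le, Set.range_subset_iff, SetLike.mem_coe] at hfew
    simpa only [Finset.bipartiteBelow] using hfew

/-- The counting bound for a single code. -/
theorem IsCoveringCode.card_mul_gaussBinom_le {F : Type} [Field F] [Fintype F] {n k δ α h : ℕ}
    {C : Finset (Submodule F (Fin n → F))} (hC : IsCoveringCode F n k δ α C) (hα : 1 ≤ α)
    (hhk : h ≤ k) (hkn : k ≤ n) (hlt : h + α * k < α * h + k + δ) :
    (C.card : ℚ) * gaussBinom (Fintype.card F) k h ≤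
      ((α : ℚ) - 1) * gaussBinom (Fintype.card F) n h := by
  have hq : 1 < Fintype.card F := Fintype.one_lt_card
  have hle : ((_ : ℕ) : ℚ) ≤ (_ : ℕ) := Nat.cast_le.2 (hC.card_mul_prod_le hhk hkn hlt)
  rw [Nat.cast_mul, Nat.cast_mul, cast_prod_pow_sub_pow hq.le hhk,
    cast_prod_pow_sub_pow hq.le (hhk.trans hkn), Nat.cast_sub hα, Nat.cast_one] at hle
  rw [gaussBinom, gaussBinom, Finset.prod_div_distrib, Finset.prod_div_distrib, ← mul_div_assoc,
    ← mul_div_assoc]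
  have hpos := prod_pow_sub_pow_pos hq (le_refl h)
  rw [div_le_div_iff_of_pos_right hpos]
  linarith

theorem exists_card_eq_maxCodeCard (F : Type) [Field F] [Fintype F] (n k δ α : ℕ) (hα : α ≠ 0) :
    ∃ C : Finset (Submodule F (Fin n → F)),
      IsCoveringCode F n k δ α C ∧ C.card = maxCodeCard F n k δ α := by
  classical
  have := Fintype.ofFinite (Submodule F (Fin n → F))
  refine Nat.sSup_mem (s := {m | ∃ C, IsCoveringCode F n k δ α C ∧ C.card = m}) ?_ ?_
  · refine ⟨0, ∅, ⟨by simp, fun S hS hcard => ?_⟩, rfl⟩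
    rw [Finset.subset_empty.1 hS] at hcard
    exact absurd hcard.symm hα
  · refine ⟨Fintype.card (Submodule F (Fin n → F)), ?_⟩
    rintro _ ⟨C, _, rfl⟩
    exact Finset.card_le_univ C

/-- Counting upper bound: for `h = ⌊k + 1 - δ/(α-1)⌋`, every
`α`-`(n,k,δ)_q^c` code `C` satisfies `|C|·[k,h]_q ≤ (α-1)·[n,h]_q`; in particular
`B_q(n,k,δ;α) ≤ (α-1)·[n,h]_q/[k,h]_q`. -/
theorem stmt_0 (q n k δ α h : ℕ) (F : Type) [Field F] [Fintype F]
    (hq : Fintype.card F = q) (hq' : IsPrimePow q)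
    (hk : 1 ≤ k) (hkn : k < n) (hδ : 1 ≤ δ) (hα : 2 ≤ α)
    (hδk : δ ≤ (α - 1) * k)
    (hh : (h : ℤ) = ⌊(k : ℚ) + 1 - (δ : ℚ) / ((α : ℚ) - 1)⌋) :
    (∀ C : Finset (Submodule F (Fin n → F)), IsCoveringCode F n k δ α C →
      (C.card : ℚ) * gaussBinom q k h ≤ ((α : ℚ) - 1) * gaussBinom q n h) ∧
    (maxCodeCard F n k δ α : ℚ) ≤ ((α : ℚ) - 1) * gaussBinom q n h / gaussBinom q k h := by
  subst hq
  have hα' : (0 : ℚ) < (α : ℚ) - 1 := by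
    have : (2 : ℚ) ≤ α := by exact_mod_cast hα
    linarith
  have hδ' : (1 : ℚ) ≤ δ := by exact_mod_cast hδ
  obtain ⟨hfloor, hfloor'⟩ := Int.floor_eq_iff.1 hh.symm
  rw [Int.cast_natCast] at hfloor hfloor'
  have hhk : h ≤ k := by
    have hdiv : 0 < (δ : ℚ) / ((α : ℚ) - 1) := by positivity
    have : (h : ℚ) < k + 1 := by linarith
    exact Nat.lt_succ_iff.1 (by exact_mod_cast this)
  have hlt : h + α * k < α * h + k + δ := by
    have hdiv : (k : ℚ) - h < (δ : ℚ) / ((α : ℚ) - 1) := by linarith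
    rw [lt_div_iff₀ hα'] at hdiv
    have : (h : ℚ) + α * k < α * h + k + δ := by linarith
    exact_mod_cast this
  have hbound : ∀ C : Finset (Submodule F (Fin n → F)), IsCoveringCode F n k δ α C →
      (C.card : ℚ) * gaussBinom (Fintype.card F) k h ≤
        ((α : ℚ) - 1) * gaussBinom (Fintype.card F) n h :=
    fun C hC => hC.card_mul_gaussBinom_le (by omega) hhk hkn.le hlt
  refine ⟨hbound, ?_⟩
  obtain ⟨C, hC, hcard⟩ := exists_card_eq_maxCodeCard F n k δ α (by omega)
  rw [← hcard, le_div_iff₀ (gaussBinom_pos Fintype.one_lt_card hhk)]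
  exact hbound C hC
end

section
/- Let q be a prime power and let n, k, δ, α be positive integers with 1 ≤ k < n, α ≥ 2 and δ ≤ (α−1)k, and set h = ⌊k + 1 − δ/(α−1)⌋. If C is an α-(n,k,δ)_q^c covering Grassmannian code, then no h-dimensional subspace of F_q^n is contained in α or more distinct members of C; equivalently, every h-dimensional subspace of F_q^n lies in at most α−1 codewords of C. -/
open Module

/-- If every member of `S` is `k`-dimensional and contains `W`, then the span of `W` and the members
of `S` has dimension at most `dim W + |S| (k - dim W)`. -/
theorem finrank_sup_add_card_mul_le {K V : Type*} [Field K] [AddCommGroup V] [Module K V]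
    [FiniteDimensional K V] (W : Submodule K V) (k : ℕ) (S : Finset (Submodule K V))
    (hS : ∀ U ∈ S, W ≤ U ∧ finrank K U = k) :
    finrank K ↥(W ⊔ S.sup id) + S.card * finrank K W ≤ finrank K W + S.card * k := by
  classical
  induction S using Finset.induction_on with
  | empty => rw [Finset.sup_empty, sup_bot_eq]; simp
  | insert U S hU ih =>
    have ih := ih fun X hX => hS X (Finset.mem_insert_of_mem hX)
    obtain ⟨hWU, hk⟩ := hS U (Finset.mem_insert_self U S)
    have hdim := Submodule.finrank_sup_add_finrank_inf_eq U (W ⊔ S.sup id)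
    have hinf : finrank K W ≤ finrank K ↥(U ⊓ (W ⊔ S.sup id)) :=
      Submodule.finrank_mono (le_inf hWU le_sup_left)
    rw [Finset.sup_insert, id_eq, sup_left_comm, Finset.card_insert_of_notMem hU,
      add_mul, add_mul]
    omega

/-- For `h = ⌊k + 1 - δ/(α-1)⌋`, every `h`-dimensional subspace of
`F_q^n` is contained in at most `α - 1` codewords of an `α`-`(n,k,δ)_q^c` code. -/
theorem stmt_1 (q n k δ α h : ℕ) (F : Type) [Field F] [Fintype F]
    (hq : Fintype.card F = q) (hq' : IsPrimePow q)
    (hk : 1 ≤ k) (hkn : k < n) (hδ : 1 ≤ δ) (hα : 2 ≤ α)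
    (hδk : δ ≤ (α - 1) * k)
    (hh : (h : ℤ) = ⌊(k : ℚ) + 1 - (δ : ℚ) / ((α : ℚ) - 1)⌋)
    (C : Finset (Submodule F (Fin n → F))) (hC : IsCoveringCode F n k δ α C)
    (W : Submodule F (Fin n → F)) (hW : finrank F ↥W = h) :
    containCount C W ≤ α - 1 := by
  classical
  by_contra! hcount
  have hcard : containCount C W = (C.filter (W ≤ ·)).card := by
    rw [containCount, Nat.subtype_card]
    simp
  obtain ⟨S, hS, hSα⟩ := Finset.exists_subset_card_eq (show α ≤ (C.filter (W ≤ ·)).card by omega)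
  have hspan := hC.2 S (hS.trans (Finset.filter_subset _ _)) hSα
  have hle := finrank_sup_add_card_mul_le W k S fun U hU =>
    have hU := Finset.mem_filter.1 (hS hU)
    ⟨hU.2, hC.1 U hU.1⟩
  have hmono : finrank F ↥(S.sup id) ≤ finrank F ↥(W ⊔ S.sup id) :=
    Submodule.finrank_mono le_sup_right
  have hlt : (k : ℚ) + 1 - δ / (α - 1) < h + 1 := by
    have := Int.lt_floor_add_one ((k : ℚ) + 1 - (δ : ℚ) / ((α : ℚ) - 1))
    rw [← hh] at this
    exact_mod_cast this
  have hα' : (0 : ℚ) < α - 1 := by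
    have : (2 : ℚ) ≤ α := by exact_mod_cast hα
    linarith
  have hδ' : ((k : ℚ) - h) * (α - 1) < δ := by
    rw [← lt_div_iff₀ hα']
    linarith
  have hbound : (k : ℚ) + δ + α * h ≤ h + α * k := by
    rw [hSα, hW] at hle
    exact_mod_cast (by omega : k + δ + α * h ≤ h + α * k)
  linarith
end

section
/- Let q be a prime power and n ≥ 6. Then B_q(n,3,3;3) ≤ (1 + 1/(2[3 choose 2]_q − 1)) · [n choose 2]_q / [3 choose 2]_q; that is, every 3-(n,3,3)_q^c covering Grassmannian code C satisfies |C| · [3 choose 2]_q · (2[3 choose 2]_q − 1) ≤ 2[3 choose 2]_q · [n choose 2]_q. -/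
open Module

/-- Counting ordered bases: linearly independent `m`-tuples are grouped by their span. -/
theorem card_submodule_finrank_mul {K V : Type*} [Field K] [Fintype K] [AddCommGroup V]
    [Module K V] [Finite V] {m : ℕ} (hm : m ≤ finrank K V) :
    Nat.card {W : Submodule K V // finrank K W = m} *
        ∏ i : Fin m, (Fintype.card K ^ m - Fintype.card K ^ i.val) =
      ∏ i : Fin m, (Fintype.card K ^ finrank K V - Fintype.card K ^ i.val) := by
  have := Fintype.ofFinite V
  have := Fintype.ofFinite {W : Submodule K V // finrank K W = m}
  have sigma_ext : ∀ x y : Σ W : {W : Submodule K V // finrank K W = m},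
      {t : Fin m → W.1 // LinearIndependent K t}, x.1.1 = y.1.1 →
      (∀ i, ((x.2.1 i : x.1.1) : V) = (y.2.1 i : y.1.1)) → x = y := by
    rintro ⟨⟨W, hW⟩, t, ht⟩ ⟨⟨W', hW'⟩, t', ht'⟩ rfl h
    obtain rfl : t = t' := funext fun i => Subtype.ext (h i)
    rfl
  let e : {s : Fin m → V // LinearIndependent K s} ≃
      Σ W : {W : Submodule K V // finrank K W = m}, {t : Fin m → W.1 // LinearIndependent K t} :=
    Equiv.ofBijective
      (fun s => ⟨⟨Submodule.span K (Set.range s.1), by simpa using finrank_span_eq_card s.2⟩,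
        ⟨_, linearIndependent_span s.2⟩⟩) <| by
      constructor
      · rintro s s' h
        have h' := congrArg (fun x : Σ W : {W : Submodule K V // finrank K W = m},
          {t : Fin m → W.1 // LinearIndependent K t} => fun i => ((x.2.1 i : x.1.1) : V)) h
        exact Subtype.ext h'
      · rintro ⟨⟨W, hW⟩, ⟨t, ht⟩⟩
        have hs : LinearIndependent K (fun i => (t i : V)) :=
          ht.map' W.subtype (Submodule.ker_subtype W)
        have hspan : Submodule.span K (Set.range fun i => (t i : V)) = W := by
          apply Submodule.eq_of_le_of_finrank_eq
          · rw [Submodule.span_le]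
            rintro _ ⟨i, rfl⟩
            exact (t i).2
          · rw [hW]
            simpa using finrank_span_eq_card hs
        exact ⟨⟨_, hs⟩, sigma_ext _ _ hspan fun _ => rfl⟩
  rw [← card_linearIndependent hm, Nat.card_congr e, Nat.card_sigma,
    Finset.sum_congr rfl (fun W _ => ?_), Finset.sum_const, smul_eq_mul, Finset.card_univ,
    Nat.card_eq_fintype_card]
  rw [card_linearIndependent W.2.ge, W.2]

/-- The Gaussian binomial coefficient counts the subspaces of a given dimension. -/
theorem card_submodule_finrank_eq_gaussBinom {K V : Type*} [Field K] [Fintype K]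
    [AddCommGroup V] [Module K V] [Finite V] {m : ℕ} (hm : m ≤ finrank K V) :
    (Nat.card {W : Submodule K V // finrank K W = m} : ℚ) =
      gaussBinom (Fintype.card K) (finrank K V) m := by
  have hq : 1 < Fintype.card K := Fintype.one_lt_card
  have cast_prod : ∀ n, m ≤ n →
      ((∏ i : Fin m, (Fintype.card K ^ n - Fintype.card K ^ i.val) : ℕ) : ℚ) =
        ∏ i ∈ Finset.range m, ((Fintype.card K : ℚ) ^ n - (Fintype.card K : ℚ) ^ i) := by
    intro n hn
    rw [← Fin.prod_univ_eq_prod_range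
      (fun i => (Fintype.card K : ℚ) ^ n - (Fintype.card K : ℚ) ^ i) m, Nat.cast_prod]
    refine Finset.prod_congr rfl fun i _ => ?_
    rw [Nat.cast_sub (Nat.pow_le_pow_right hq.le (i.2.le.trans hn))]
    push_cast
    rfl
  rw [gaussBinom, Finset.prod_div_distrib, ← cast_prod _ hm, ← cast_prod _ le_rfl, eq_div_iff,
    ← card_submodule_finrank_mul hm, Nat.cast_mul]
  rw [Nat.cast_ne_zero, Finset.prod_ne_zero_iff]
  intro i _
  have := Nat.pow_lt_pow_right hq i.2
  omega

/-- The `m`-dimensional subspaces of `V` contained in `U` are those of `U`. -/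
theorem card_submodule_le_eq_gaussBinom {K V : Type*} [Field K] [Fintype K]
    [AddCommGroup V] [Module K V] [Finite V] {m : ℕ} (U : Submodule K V)
    (hm : m ≤ finrank K U) :
    (Nat.card {W : Submodule K V // finrank K W = m ∧ W ≤ U} : ℚ) =
      gaussBinom (Fintype.card K) (finrank K U) m := by
  rw [← card_submodule_finrank_eq_gaussBinom hm]
  congr 1
  refine Nat.card_congr (Equiv.ofBijective (fun W => ⟨W.1.map U.subtype,
    by rw [Submodule.finrank_map_subtype_eq, W.2], Submodule.map_subtype_le _ _⟩) ⟨?_, ?_⟩).symm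
  · intro W W' h
    exact Subtype.ext (Submodule.map_injective_of_injective U.injective_subtype
      (congrArg Subtype.val h))
  · rintro ⟨W, hW, hWU⟩
    have hmap : (W.comap U.subtype).map U.subtype = W := by
      rw [Submodule.map_comap_subtype, inf_eq_right.mpr hWU]
    refine ⟨⟨W.comap U.subtype, ?_⟩, Subtype.ext hmap⟩
    rw [← Submodule.finrank_map_subtype_eq, hmap, hW]

/-- Two subspaces sharing `L` have a sum that is smaller by at least the dimension of `L`. -/
theorem finrank_sup_add_le_of_le {K V : Type*} [Field K] [AddCommGroup V] [Module K V]
    [FiniteDimensional K V] {L A B : Submodule K V} (hA : L ≤ A) (hB : L ≤ B) :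
    finrank K ↥(A ⊔ B) + finrank K L ≤ finrank K A + finrank K B := by
  have h := Submodule.finrank_sup_add_finrank_inf_eq A B
  have h' := Submodule.finrank_mono (le_inf hA hB)
  omega

/-- Distinct subspaces of dimension `m + 1` share at most one `m`-dimensional subspace. -/
theorem eq_of_le_of_le_of_ne {K V : Type*} [Field K] [AddCommGroup V] [Module K V]
    [FiniteDimensional K V] {m : ℕ} {L L' U W : Submodule K V} (hU : finrank K U = m + 1)
    (hW : finrank K W = m + 1) (hUW : U ≠ W) (hL : finrank K L = m) (hL' : finrank K L' = m)
    (hLU : L ≤ U) (hLW : L ≤ W) (hLU' : L' ≤ U) (hLW' : L' ≤ W) : L = L' := by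
  have hinf : finrank K ↥(U ⊓ W) ≤ m := by
    by_contra! h
    apply hUW
    rw [← Submodule.eq_of_le_of_finrank_le (inf_le_left : U ⊓ W ≤ U) (by omega)]
    exact Submodule.eq_of_le_of_finrank_le (inf_le_right : U ⊓ W ≤ W) (by omega)
  rw [Submodule.eq_of_le_of_finrank_le (le_inf hLU hLW) (by omega),
    Submodule.eq_of_le_of_finrank_le (le_inf hLU' hLW') (by omega)]

namespace IsCoveringCode

variable {F : Type} [Field F] {n : ℕ} {C : Finset (Submodule F (Fin n → F))}

/-- A codeword meets at most one other codeword in a `2`-dimensional subspace. -/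
theorem eq_of_shared_lines (hC : IsCoveringCode F n 3 3 3 C)
    {U V W L L' : Submodule F (Fin n → F)} (hU : U ∈ C) (hV : V ∈ C) (hW : W ∈ C)
    (hUV : U ≠ V) (hUW : U ≠ W) (hL : finrank F L = 2) (hL' : finrank F L' = 2)
    (hLU : L ≤ U) (hLV : L ≤ V) (hLU' : L' ≤ U) (hLW : L' ≤ W) : V = W := by
  classical
  by_contra hVW
  have h := hC.2 {U, V, W} (by simp [Finset.insert_subset_iff, hU, hV, hW])
    (Finset.card_eq_three.mpr ⟨U, V, W, hUV, hUW, hVW, rfl⟩)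
  have hsup : ({U, V, W} : Finset (Submodule F (Fin n → F))).sup id = U ⊔ V ⊔ W := by
    simp [sup_assoc]
  rw [hsup] at h
  have h₁ := finrank_sup_add_le_of_le hLU hLV
  have h₂ := finrank_sup_add_le_of_le (hLU'.trans (le_sup_left : U ≤ U ⊔ V)) hLW
  have := hC.1 U hU
  have := hC.1 V hV
  have := hC.1 W hW
  omega

/-- A `2`-dimensional subspace lies in at most two codewords. -/
theorem card_filter_le (hC : IsCoveringCode F n 3 3 3 C) [DecidableLE (Submodule F (Fin n → F))]
    {L : Submodule F (Fin n → F)} (hL : finrank F L = 2) : (C.filter (L ≤ ·)).card ≤ 2 := by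
  by_contra! h
  obtain ⟨U, hU, V, hV, W, hW, hUV, hUW, hVW⟩ := Finset.two_lt_card.mp h
  rw [Finset.mem_filter] at hU hV hW
  exact hVW (hC.eq_of_shared_lines hU.1 hV.1 hW.1 hUV hUW hL hL hU.2 hV.2 hU.2 hW.2)

/-- A codeword contains at most one `2`-dimensional subspace that lies in two codewords. -/
theorem eq_of_card_filter_eq_two (hC : IsCoveringCode F n 3 3 3 C)
    [DecidableLE (Submodule F (Fin n → F))] {U L L' : Submodule F (Fin n → F)} (hU : U ∈ C)
    (hL : finrank F L = 2) (hL' : finrank F L' = 2) (hLU : L ≤ U) (hLU' : L' ≤ U)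
    (hd : (C.filter (L ≤ ·)).card = 2) (hd' : (C.filter (L' ≤ ·)).card = 2) : L = L' := by
  obtain ⟨V, hV, hVU⟩ := Finset.exists_mem_ne (by omega : 1 < (C.filter (L ≤ ·)).card) U
  obtain ⟨W, hW, hWU⟩ := Finset.exists_mem_ne (by omega : 1 < (C.filter (L' ≤ ·)).card) U
  rw [Finset.mem_filter] at hV hW
  obtain rfl := hC.eq_of_shared_lines hU hV.1 hW.1 hVU.symm hWU.symm hL hL' hLU hV.2 hLU' hW.2
  exact eq_of_le_of_le_of_ne (hC.1 U hU) (hC.1 V hV.1) hVU.symm hL hL' hLU hV.2 hLU' hW.2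

/-- Double counting of incidences between codewords and the `2`-dimensional subspaces in a finite
set `T`. -/
theorem two_mul_sum_card_filter_le (hC : IsCoveringCode F n 3 3 3 C)
    [DecidableLE (Submodule F (Fin n → F))] {T : Finset (Submodule F (Fin n → F))}
    (hT : ∀ L ∈ T, finrank F L = 2) :
    2 * ∑ U ∈ C, (T.filter (· ≤ U)).card ≤ 2 * T.card + C.card := by
  have hswap : ∀ S : Finset (Submodule F (Fin n → F)),
      ∑ U ∈ C, (S.filter (· ≤ U)).card = ∑ L ∈ S, (C.filter (L ≤ ·)).card := fun S =>
    (Finset.sum_card_bipartiteAbove_eq_sum_card_bipartiteBelow (s := S) (t := C)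
      (fun L U => L ≤ U)).symm
  have hdouble : ∑ L ∈ T with (C.filter (L ≤ ·)).card = 2, (C.filter (L ≤ ·)).card ≤ C.card := by
    rw [← hswap, Finset.card_eq_sum_ones]
    refine Finset.sum_le_sum fun U hU => Finset.card_le_one.mpr fun L hL L' hL' => ?_
    simp only [Finset.mem_filter] at hL hL'
    exact hC.eq_of_card_filter_eq_two hU (hT L hL.1.1) (hT L' hL'.1.1) hL.2 hL'.2 hL.1.2 hL'.1.2
  calc 2 * ∑ U ∈ C, (T.filter (· ≤ U)).card
      = ∑ L ∈ T, 2 * (C.filter (L ≤ ·)).card := by rw [hswap, Finset.mul_sum]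
    _ ≤ ∑ L ∈ T, (2 + if (C.filter (L ≤ ·)).card = 2 then (C.filter (L ≤ ·)).card else 0) := by
        refine Finset.sum_le_sum fun L hL => ?_
        have := hC.card_filter_le (hT L hL)
        split_ifs <;> omega
    _ ≤ 2 * T.card + C.card := by
        rw [Finset.sum_add_distrib, Finset.sum_const, smul_eq_mul, mul_comm, ← Finset.sum_filter]
        exact Nat.add_le_add_left hdouble _

end IsCoveringCode

/-- For `n ≥ 6`, every `3`-`(n,3,3)_q^c` code `C` satisfies
`|C|·[3,2]_q·(2[3,2]_q − 1) ≤ 2[3,2]_q·[n,2]_q`, i.e.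
`B_q(n,3,3;3) ≤ (1 + 1/(2[3,2]_q − 1))·[n,2]_q/[3,2]_q`. -/
theorem stmt_2 (q n : ℕ) (F : Type) [Field F] [Fintype F]
    (hq : Fintype.card F = q) (hq' : IsPrimePow q) (hn : 6 ≤ n)
    (C : Finset (Submodule F (Fin n → F))) (hC : IsCoveringCode F n 3 3 3 C) :
    (C.card : ℚ) * gaussBinom q 3 2 * (2 * gaussBinom q 3 2 - 1) ≤
      2 * gaussBinom q 3 2 * gaussBinom q n 2 := by
  classical
  subst hq
  have := Fintype.ofFinite (Submodule F (Fin n → F))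
  set T : Finset (Submodule F (Fin n → F)) := {L | finrank F L = 2}
  have hT : (T.card : ℚ) = gaussBinom (Fintype.card F) n 2 := by
    have h := card_submodule_finrank_eq_gaussBinom (K := F) (V := Fin n → F) (m := 2)
      (by rw [finrank_fin_fun]; omega)
    rwa [finrank_fin_fun, Nat.card_eq_fintype_card, Fintype.card_subtype] at h
  have hline : ∀ U ∈ C, ((T.filter (· ≤ U)).card : ℚ) = gaussBinom (Fintype.card F) 3 2 := by
    intro U hU
    have h := card_submodule_le_eq_gaussBinom (m := 2) U (by rw [hC.1 U hU]; omega)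
    rwa [hC.1 U hU, Nat.card_eq_fintype_card, Fintype.card_subtype, ← Finset.filter_filter] at h
  have hcount : 2 * ((C.card : ℚ) * gaussBinom (Fintype.card F) 3 2) ≤
      2 * gaussBinom (Fintype.card F) n 2 + C.card := by
    have h := hC.two_mul_sum_card_filter_le (T := T) (fun L hL => (Finset.mem_filter.mp hL).2)
    rw [← hT, ← nsmul_eq_mul, ← Finset.sum_const, ← Finset.sum_congr rfl hline]
    exact_mod_cast h
  have hpos : 0 ≤ gaussBinom (Fintype.card F) 3 2 := by
    have h := card_submodule_finrank_eq_gaussBinom (K := F) (V := Fin 3 → F) (m := 2) (by simp)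
    rw [finrank_fin_fun] at h
    rw [← h]
    positivity
  nlinarith [mul_le_mul_of_nonneg_left hcount hpos]
end

section
/- Let q be a prime power, n ≥ 6, and let C be a 3-(n,3,3)_q^c covering Grassmannian code. For i ∈ {1,2}, let b_i denote the number of 2-dimensional subspaces of F_q^n that are contained in exactly i members of C. Then b_1 ≥ 2([3 choose 2]_q − 1) · b_2. -/
open Module

theorem gaussBinom_three_two {q : ℕ} (hq : 1 < q) :
    gaussBinom q 3 2 = (q : ℚ) ^ 2 + q + 1 := by
  have h : (1 : ℚ) < q := by exact_mod_cast hq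
  have h₁ : (q : ℚ) ^ 2 - 1 ≠ 0 := by nlinarith
  have h₂ : (q : ℚ) ^ 2 - q ≠ 0 := by nlinarith
  simp only [gaussBinom, Finset.prod_range_succ, Finset.prod_range_zero, pow_zero, pow_one, one_mul]
  rw [div_mul_div_comm, div_eq_iff (mul_ne_zero h₁ h₂)]
  ring

section PlaneCount

variable {F E : Type*} [Field F] [AddCommGroup E] [Module F E]

/-- The hyperplanes of a finite-dimensional space correspond to the lines of its dual. -/
noncomputable def hyperplaneEquivDualLine [FiniteDimensional F E] {d : ℕ}
    (h : finrank F E = d + 1) :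
    {V : Submodule F E // finrank F V = d} ≃ {L : Submodule F (Dual F E) // finrank F L = 1} :=
  (Subspace.orderIsoFiniteDimensional (K := F) (V := E)).toEquiv.trans OrderDual.ofDual
    |>.subtypeEquiv fun V ↦ by
      have := Subspace.finrank_add_finrank_dualAnnihilator_eq V
      change finrank F V = d ↔ finrank F V.dualAnnihilator = 1
      lia

theorem card_hyperplanes [Finite F] {d : ℕ} (h : finrank F E = d + 1) :
    Nat.card {V : Submodule F E // finrank F V = d} =
      ∑ i ∈ Finset.range (d + 1), Nat.card F ^ i := by
  have : FiniteDimensional F E := .of_finrank_eq_succ h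
  rw [Nat.card_congr ((hyperplaneEquivDualLine h).trans
    (Projectivization.equivSubmodule F (Dual F E)).symm)]
  exact Projectivization.card_of_finrank F _ (by rw [Subspace.dual_finrank_eq, h])

theorem card_hyperplanes_of_submodule [Finite F] {d : ℕ} {U : Submodule F E}
    (h : finrank F U = d + 1) :
    Nat.card {V : Submodule F E // finrank F V = d ∧ V ≤ U} =
      ∑ i ∈ Finset.range (d + 1), Nat.card F ^ i := by
  rw [← card_hyperplanes h]
  refine (Nat.card_congr (((U.mapIic.toEquiv.subtypeEquiv fun V ↦ ?_).trans
    (Equiv.subtypeSubtypeEquivSubtypeInter (· ≤ U) (finrank F · = d))).trans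
    (Equiv.subtypeEquivRight fun V ↦ and_comm))).symm
  change _ ↔ finrank F (V.map U.subtype) = d
  rw [Submodule.finrank_map_subtype_eq]

end PlaneCount

section CoveringCode

variable {F : Type} [Field F] {n : ℕ} {C : Finset (Submodule F (Fin n → F))}
  {U U₁ U₂ V W X : Submodule F (Fin n → F)}

open Classical in
theorem containCount_eq_card_filter (C : Finset (Submodule F (Fin n → F)))
    (W : Submodule F (Fin n → F)) : containCount C W = (C.filter (W ≤ ·)).card := by
  exact Nat.subtype_card _ fun _ ↦ Finset.mem_filter

namespace IsCoveringCode

/-- A codeword shares a plane with at most one other codeword. -/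
theorem eq_of_plane_le (hC : IsCoveringCode F n 3 3 3 C) (hU : U ∈ C) (hU₁ : U₁ ∈ C)
    (hU₂ : U₂ ∈ C) (h₁ : U ≠ U₁) (h₂ : U ≠ U₂) (hW : finrank F W = 2) (hV : finrank F V = 2)
    (hWU : W ≤ U) (hWU₁ : W ≤ U₁) (hVU : V ≤ U) (hVU₂ : V ≤ U₂) : U₁ = U₂ := by
  classical
  by_contra h
  have hspan := hC.2 {U, U₁, U₂} (by simp [Finset.insert_subset_iff, *])
    (Finset.card_eq_three.2 ⟨_, _, _, h₁, h₂, h, rfl⟩)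
  have hsup : ({U, U₁, U₂} : Finset (Submodule F (Fin n → F))).sup id = U ⊔ U₁ ⊔ U₂ := by
    simp [sup_assoc]
  rw [hsup] at hspan
  have e₁ := Submodule.finrank_sup_add_finrank_inf_eq U U₁
  have e₂ := Submodule.finrank_sup_add_finrank_inf_eq (U ⊔ U₁) U₂
  have i₁ := Submodule.finrank_mono (le_inf hWU hWU₁)
  have i₂ := Submodule.finrank_mono (le_inf (hVU.trans le_sup_left : V ≤ U ⊔ U₁) hVU₂)
  have := hC.1 U hU
  have := hC.1 U₁ hU₁
  have := hC.1 U₂ hU₂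
  lia

/-- Two distinct codewords share at most one plane. -/
theorem plane_unique (hC : IsCoveringCode F n 3 3 3 C) (hU : U ∈ C) (hU₁ : U₁ ∈ C)
    (h₁ : U ≠ U₁) (hW : finrank F W = 2) (hV : finrank F V = 2)
    (hWU : W ≤ U) (hWU₁ : W ≤ U₁) (hVU : V ≤ U) (hVU₁ : V ≤ U₁) : V = W := by
  have hinf : finrank F ↥(U ⊓ U₁) ≤ 2 := by
    by_contra! h
    have d := hC.1 U hU
    have d₁ := hC.1 U₁ hU₁
    exact h₁ ((Submodule.eq_of_le_of_finrank_le inf_le_left (by lia)).symm.trans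
      (Submodule.eq_of_le_of_finrank_le inf_le_right (by lia)))
  exact (Submodule.eq_of_le_of_finrank_le (le_inf hVU hVU₁) (by lia)).trans
    (Submodule.eq_of_le_of_finrank_le (le_inf hWU hWU₁) (by lia)).symm

theorem codeword_unique (hC : IsCoveringCode F n 3 3 3 C) (hW : finrank F W = 2)
    (hWC : containCount C W = 2) (hU : U ∈ C) (hWU : W ≤ U) (hV : finrank F V = 2) (hVW : V ≠ W)
    (hVU : V ≤ U) (hX : X ∈ C) (hVX : V ≤ X) : X = U := by
  classical
  rw [containCount_eq_card_filter] at hWC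
  obtain ⟨U', hU', hne⟩ := Finset.exists_mem_ne (by lia : 1 < (C.filter (W ≤ ·)).card) U
  rw [Finset.mem_filter] at hU'
  by_contra hXU
  obtain rfl := hC.eq_of_plane_le hU hU'.1 hX hne.symm (Ne.symm hXU) hW hV hWU hU'.2 hVU hVX
  exact hVW (hC.plane_unique hU hX hne.symm hW hV hWU hU'.2 hVU hVX)

end IsCoveringCode

end CoveringCode

/-- If `C` is a `3`-`(n,3,3)_q^c` code and `b i` is the number of
`2`-dimensional subspaces of `F_q^n` contained in exactly `i` members of `C`, then
`b 1 ≥ 2·([3,2]_q − 1)·b 2`. -/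
theorem stmt_3 (q n : ℕ) (F : Type) [Field F] [Fintype F]
    (hq : Fintype.card F = q) (hq' : IsPrimePow q) (hn : 6 ≤ n)
    (C : Finset (Submodule F (Fin n → F))) (hC : IsCoveringCode F n 3 3 3 C)
    (b : ℕ → ℕ)
    (hb : ∀ i, b i = Nat.card {W : Submodule F (Fin n → F) //
      finrank F ↥W = 2 ∧ containCount C W = i}) :
    2 * (gaussBinom q 3 2 - 1) * (b 2 : ℚ) ≤ (b 1 : ℚ) := by
  classical
  have : Finite (Submodule F (Fin n → F)) := Finite.of_injective _ SetLike.coe_injective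
  have := Fintype.ofFinite (Submodule F (Fin n → F))
  let planes (i : ℕ) : Finset (Submodule F (Fin n → F)) :=
    {W | finrank F W = 2 ∧ containCount C W = i}
  let others (W U : Submodule F (Fin n → F)) : Finset (Submodule F (Fin n → F)) :=
    ({V | finrank F V = 2 ∧ V ≤ U} : Finset (Submodule F (Fin n → F))).erase W
  have hb' (i : ℕ) : b i = (planes i).card := by
    rw [hb, Nat.card_eq_fintype_card, Fintype.card_subtype]
  have card_others {W U : Submodule F (Fin n → F)} (hW : finrank F W = 2) (hU : U ∈ C) (hWU : W ≤ U) :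
      (others W U).card = q ^ 2 + q := by
    have h := card_hyperplanes_of_submodule (hC.1 U hU)
    rw [Nat.card_eq_fintype_card, Fintype.card_subtype, Nat.card_eq_fintype_card, hq] at h
    rw [Finset.card_erase_of_mem (by simp [hW, hWU]), h]
    simp only [Finset.sum_range_succ, Finset.sum_range_zero]
    lia
  let nearby (W : Submodule F (Fin n → F)) := (C.filter (W ≤ ·)).biUnion (others W)
  have mem_nearby {W V} : V ∈ nearby W ↔
      ∃ U, (U ∈ C ∧ W ≤ U) ∧ V ≠ W ∧ finrank F V = 2 ∧ V ≤ U := by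
    simp only [nearby, others, Finset.mem_biUnion, Finset.mem_filter, Finset.mem_erase,
      Finset.mem_univ, true_and]
  have card_nearby {W} (hW : W ∈ planes 2) : (nearby W).card = 2 * (q ^ 2 + q) := by
    simp only [planes, Finset.mem_filter_univ] at hW
    rw [Finset.card_biUnion, Finset.sum_congr rfl (g := fun _ ↦ q ^ 2 + q),
      Finset.sum_const, ← containCount_eq_card_filter, hW.2, smul_eq_mul]
    · intro U hU
      rw [Finset.mem_filter] at hU
      exact card_others hW.1 hU.1 hU.2
    · intro U hU X hX hne
      rw [Finset.mem_coe, Finset.mem_filter] at hU hX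
      rw [Function.onFun, Finset.disjoint_left]
      intro V hV hV'
      simp only [others, Finset.mem_erase, Finset.mem_filter_univ] at hV hV'
      exact hne (hC.codeword_unique hW.1 hW.2 hU.1 hU.2 hV.2.1 hV.1 hV.2.2 hX.1 hV'.2.2).symm
  have nearby_subset {W} (hW : W ∈ planes 2) : nearby W ⊆ planes 1 := by
    intro V hV
    obtain ⟨U, ⟨hU, hWU⟩, hVW, hV2, hVU⟩ := mem_nearby.1 hV
    simp only [planes, Finset.mem_filter_univ] at hW ⊢
    refine ⟨hV2, ?_⟩
    rw [containCount_eq_card_filter, Finset.card_eq_one]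
    refine ⟨U, Finset.eq_singleton_iff_unique_mem.2 ⟨by simp [hU, hVU], fun X hX ↦ ?_⟩⟩
    rw [Finset.mem_filter] at hX
    exact hC.codeword_unique hW.1 hW.2 hU hWU hV2 hVW hVU hX.1 hX.2
  have disjoint_nearby : (planes 2 : Set _).PairwiseDisjoint nearby := by
    intro W hW W' hW' hne
    rw [Function.onFun, Finset.disjoint_left]
    intro V hV hV'
    obtain ⟨U, ⟨hU, hWU⟩, hVW, hV2, hVU⟩ := mem_nearby.1 hV
    obtain ⟨U', ⟨hU', hWU'⟩, -, -, hVU'⟩ := mem_nearby.1 hV'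
    rw [Finset.mem_coe] at hW hW'
    have hW₂ := hW
    simp only [planes, Finset.mem_filter_univ] at hW₂ hW'
    obtain rfl := hC.codeword_unique hW₂.1 hW₂.2 hU hWU hV2 hVW hVU hU' hVU'
    have h₁ := nearby_subset hW (mem_nearby.2 ⟨U', ⟨hU, hWU⟩, hne.symm, hW'.1, hWU'⟩)
    simp only [planes, Finset.mem_filter_univ] at h₁
    lia
  have key : 2 * (q ^ 2 + q) * b 2 ≤ b 1 := by
    calc 2 * (q ^ 2 + q) * b 2 = ((planes 2).biUnion nearby).card := by
          rw [Finset.card_biUnion disjoint_nearby, Finset.sum_congr rfl fun W ↦ card_nearby,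
            Finset.sum_const, smul_eq_mul, hb', mul_comm]
      _ ≤ b 1 := by
          rw [hb']
          exact Finset.card_le_card (Finset.biUnion_subset.2 fun W ↦ nearby_subset)
  rw [gaussBinom_three_two hq'.one_lt, add_sub_cancel_right]
  exact_mod_cast key
end

section
/- Let q be a prime power and let n, k, δ be positive integers with 1 ≤ k < n and δ ≤ 2k, and set h = ⌊k + 1 − δ/2⌋. Then B_q(n,k,δ;3) ≤ (1 + 1/(2[k choose h]_q − 1)) · [n choose h]_q / [k choose h]_q; that is, every 3-(n,k,δ)_q^c covering Grassmannian code C satisfies |C| · [k choose h]_q · (2[k choose h]_q − 1) ≤ 2[k choose h]_q · [n choose h]_q. -/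
open Module

section Counting

variable {F V : Type*} [Field F] [AddCommGroup V] [Module F V]

/-- Linearly independent families spanning `T` are linearly independent families in `T`. -/
noncomputable def linearIndependentSpanEquiv [FiniteDimensional F V] {h : ℕ}
    (T : Submodule F V) (hT : finrank F T = h) :
    {s : {s : Fin h → V // LinearIndependent F s} //
      Submodule.span F (Set.range s.1) = T} ≃ {s : Fin h → T // LinearIndependent F s} where
  toFun s := ⟨fun i => ⟨s.1.1 i, s.2.le (Submodule.subset_span ⟨i, rfl⟩)⟩,
    LinearIndependent.of_comp T.subtype s.1.2⟩
  invFun s := ⟨⟨fun i => s.1 i, s.2.map' T.subtype T.ker_subtype⟩, by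
    have hli : LinearIndependent F (fun i => (s.1 i : V)) := s.2.map' T.subtype T.ker_subtype
    apply Submodule.eq_of_le_of_finrank_eq
    · rw [Submodule.span_le]
      rintro _ ⟨i, rfl⟩
      exact (s.1 i).2
    · rw [finrank_span_eq_card hli, hT, Fintype.card_fin]⟩
  left_inv s := rfl
  right_inv s := rfl

theorem card_submodule_mul_prod [Fintype F] [Finite V] {h : ℕ} (hh : h ≤ finrank F V) :
    Nat.card {T : Submodule F V // finrank F T = h} *
        ∏ i : Fin h, (Fintype.card F ^ h - Fintype.card F ^ i.val) =
      ∏ i : Fin h, (Fintype.card F ^ finrank F V - Fintype.card F ^ i.val) := by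
  classical
  have := Fintype.ofFinite {T : Submodule F V // finrank F T = h}
  let f : {s : Fin h → V // LinearIndependent F s} → {T : Submodule F V // finrank F T = h} :=
    fun s => ⟨Submodule.span F (Set.range s.1), by
      rw [finrank_span_eq_card s.2, Fintype.card_fin]⟩
  rw [← card_linearIndependent (K := F) (V := V) hh,
    ← Nat.card_congr (Equiv.sigmaFiberEquiv f), Nat.card_sigma]
  have key (T : {T : Submodule F V // finrank F T = h}) :
      Nat.card {s // f s = T} = ∏ i : Fin h, (Fintype.card F ^ h - Fintype.card F ^ i.val) := by
    have e : {s // f s = T} ≃ {s : Fin h → T.1 // LinearIndependent F s} :=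
      (Equiv.subtypeEquivRight fun s => Subtype.ext_iff).trans
        (linearIndependentSpanEquiv T.1 T.2)
    rw [Nat.card_congr e, card_linearIndependent T.2.ge, T.2]
  simp [key, Nat.card_eq_fintype_card]

theorem card_submodule_eq_gaussBinom [Fintype F] [Finite V] {h : ℕ} (hh : h ≤ finrank F V) :
    (Nat.card {T : Submodule F V // finrank F T = h} : ℚ) =
      gaussBinom (Fintype.card F) (finrank F V) h := by
  have hq : 1 < Fintype.card F := Fintype.one_lt_card
  have hcast {m : ℕ} (hm : h ≤ m) :
      ((∏ i : Fin h, (Fintype.card F ^ m - Fintype.card F ^ i.val) : ℕ) : ℚ) =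
        ∏ i ∈ Finset.range h, ((Fintype.card F : ℚ) ^ m - (Fintype.card F : ℚ) ^ i) := by
    rw [Finset.prod_range, Nat.cast_prod]
    refine Finset.prod_congr rfl fun i _ => ?_
    rw [Nat.cast_sub (Nat.pow_le_pow_right hq.le (i.2.le.trans hm))]
    push_cast
    rfl
  have hne : ∏ i ∈ Finset.range h,
      ((Fintype.card F : ℚ) ^ h - (Fintype.card F : ℚ) ^ i) ≠ 0 := by
    refine Finset.prod_ne_zero_iff.2 fun i hi => (sub_pos.2 ?_).ne'
    exact pow_lt_pow_right₀ (by exact_mod_cast hq) (Finset.mem_range.1 hi)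
  rw [gaussBinom, Finset.prod_div_distrib, eq_div_iff hne, ← hcast le_rfl, ← hcast hh,
    ← card_submodule_mul_prod hh, Nat.cast_mul]

/-- The number of `h`-dimensional subspaces of the subspace `X`. -/
noncomputable def subspaceCount (h : ℕ) (X : Submodule F V) : ℕ :=
  Nat.card {T : Submodule F V // finrank F T = h ∧ T ≤ X}

theorem subspaceCount_eq_gaussBinom [Fintype F] [Finite V] {h : ℕ} {X : Submodule F V}
    (hX : h ≤ finrank F X) :
    (subspaceCount h X : ℚ) = gaussBinom (Fintype.card F) (finrank F X) h := by
  rw [← card_submodule_eq_gaussBinom hX, subspaceCount, Nat.cast_inj]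
  refine Nat.card_congr (Equiv.symm ?_)
  refine ((Submodule.mapIic X).toEquiv.subtypeEquiv
    (q := fun T => finrank F T.1 = h) fun T => ?_).trans ?_
  · change _ ↔ finrank F ↥(T.map X.subtype) = h
    rw [Submodule.finrank_map_subtype_eq]
  · exact (Equiv.subtypeSubtypeEquivSubtypeInter (fun T => T ≤ X)
      (fun T : Submodule F V => finrank F T = h)).trans
      (Equiv.subtypeEquivRight fun T => and_comm)

theorem subspaceCount_mono [Finite V] {h : ℕ} {X Y : Submodule F V} (hXY : X ≤ Y) :
    subspaceCount h X ≤ subspaceCount h Y :=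
  Nat.card_le_card_of_injective
    (fun T : {T : Submodule F V // finrank F T = h ∧ T ≤ X} =>
      (⟨T.1, T.2.1, T.2.2.trans hXY⟩ : {T : Submodule F V // finrank F T = h ∧ T ≤ Y}))
    fun _ _ hST => Subtype.ext (Subtype.mk.inj hST)

theorem subspaceCount_eq_zero [FiniteDimensional F V] {h : ℕ} {X : Submodule F V}
    (hX : finrank F X < h) : subspaceCount h X = 0 := by
  have : IsEmpty {T : Submodule F V // finrank F T = h ∧ T ≤ X} :=
    ⟨fun T => (T.2.1 ▸ Submodule.finrank_mono T.2.2).not_gt hX⟩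
  exact Nat.card_of_isEmpty

theorem subspaceCount_le_one [FiniteDimensional F V] {h : ℕ} {X : Submodule F V}
    (hX : finrank F X ≤ h) : subspaceCount h X ≤ 1 := by
  have heq (T : {T : Submodule F V // finrank F T = h ∧ T ≤ X}) : T.1 = X :=
    Submodule.eq_of_le_of_finrank_le T.2.2 (hX.trans T.2.1.ge)
  have : Subsingleton {T : Submodule F V // finrank F T = h ∧ T ≤ X} :=
    ⟨fun S T => Subtype.ext ((heq S).trans (heq T).symm)⟩
  exact Finite.card_le_one_iff_subsingleton.2 this

/-- Bonferroni-type inequality: `m (3 - m) ≤ 2` summed over all `h`-dimensional subspaces, where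
`m` counts the members of the family `E` containing a given subspace. -/
theorem sum_subspaceCount_le [Finite V] {ι : Type*} [DecidableEq ι] (h : ℕ) (s : Finset ι)
    (E : ι → Submodule F V) :
    ∑ i ∈ s, (2 * (subspaceCount h (E i) : ℤ) -
        ∑ j ∈ s.erase i, (subspaceCount h (E i ⊓ E j) : ℤ)) ≤
      2 * (subspaceCount h (⊤ : Submodule F V) : ℤ) := by
  classical
  have := Fintype.ofFinite {T : Submodule F V // finrank F T = h}
  have hcount (X : Submodule F V) : (subspaceCount h X : ℤ) =
      ∑ T : {T : Submodule F V // finrank F T = h}, if T.1 ≤ X then 1 else 0 := by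
    rw [Finset.sum_boole, ← Fintype.card_subtype, ← Nat.card_eq_fintype_card, subspaceCount,
      Nat.card_congr (Equiv.subtypeSubtypeEquivSubtypeInter
        (fun T : Submodule F V => finrank F T = h) (fun T => T ≤ X))]
  have herase (i : ι) (hi : i ∈ s) : 2 * (subspaceCount h (E i) : ℤ) -
        ∑ j ∈ s.erase i, (subspaceCount h (E i ⊓ E j) : ℤ) =
      ∑ T : {T : Submodule F V // finrank F T = h}, (if T.1 ≤ E i then 1 else 0) *
        (3 - ∑ j ∈ s, if T.1 ≤ E j then (1 : ℤ) else 0) := by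
    have h1 := Finset.add_sum_erase s (fun j => (subspaceCount h (E i ⊓ E j) : ℤ)) hi
    simp only [inf_idem] at h1
    have h2 : ∑ j ∈ s, (subspaceCount h (E i ⊓ E j) : ℤ) =
        ∑ T : {T : Submodule F V // finrank F T = h}, (if T.1 ≤ E i then 1 else 0) *
          (∑ j ∈ s, if T.1 ≤ E j then (1 : ℤ) else 0) := by
      simp only [hcount]
      rw [Finset.sum_comm]
      refine Finset.sum_congr rfl fun T _ => ?_
      rw [Finset.mul_sum]
      refine Finset.sum_congr rfl fun j _ => ?_
      simp only [le_inf_iff, ite_and, ite_mul, one_mul, zero_mul]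
    simp only [mul_sub, Finset.sum_sub_distrib, ← h2, ← Finset.sum_mul, ← hcount]
    linarith
  rw [Finset.sum_congr rfl herase, Finset.sum_comm, hcount, Finset.mul_sum]
  refine Finset.sum_le_sum fun T _ => ?_
  rw [← Finset.sum_mul]
  set m := ∑ j ∈ s, if T.1 ≤ E j then (1 : ℤ) else 0
  simp only [le_top, if_true]
  rcases le_or_gt m 1 with hm | hm <;> nlinarith

end Counting

/-- Adding one dimension at least doubles the number of `h`-dimensional subspaces. -/
theorem two_mul_gaussBinom_le {q k h : ℕ} (hq : 2 ≤ q) (hh : 1 ≤ h) (hk : h ≤ k) :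
    2 * gaussBinom q k h ≤ gaussBinom q (k + 1) h := by
  have hq' : (2 : ℚ) ≤ q := by exact_mod_cast hq
  have hlt {m i : ℕ} (hi : i < m) : (q : ℚ) ^ i < (q : ℚ) ^ m :=
    pow_lt_pow_right₀ (by linarith) hi
  have hfac (i : ℕ) (hi : i ∈ Finset.range h) :
      0 ≤ (q : ℚ) * (((q : ℚ) ^ k - (q : ℚ) ^ i) / ((q : ℚ) ^ h - (q : ℚ) ^ i)) ∧
      (q : ℚ) * (((q : ℚ) ^ k - (q : ℚ) ^ i) / ((q : ℚ) ^ h - (q : ℚ) ^ i)) ≤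
        ((q : ℚ) ^ (k + 1) - (q : ℚ) ^ i) / ((q : ℚ) ^ h - (q : ℚ) ^ i) := by
    have hi' := Finset.mem_range.1 hi
    have h1 := sub_pos.2 (hlt hi')
    have h2 := sub_pos.2 (hlt (hi'.trans_le hk))
    refine ⟨by positivity, ?_⟩
    rw [← mul_div_assoc, pow_succ]
    gcongr
    have : (0 : ℚ) < (q : ℚ) ^ i := by positivity
    nlinarith
  have hnonneg : 0 ≤ gaussBinom q k h := Finset.prod_nonneg fun i hi =>
    nonneg_of_mul_nonneg_right (hfac i hi).1 (by linarith)
  calc 2 * gaussBinom q k h ≤ (q : ℚ) ^ h * gaussBinom q k h := by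
        gcongr
        exact hq'.trans (le_self_pow₀ (by linarith) (by omega))
    _ ≤ gaussBinom q (k + 1) h := by
        have := Finset.prod_le_prod (fun i hi => (hfac i hi).1) fun i hi => (hfac i hi).2
        rwa [Finset.prod_mul_distrib, Finset.prod_const, Finset.card_range] at this

section Dimension

variable {F V : Type*} [Field F] [AddCommGroup V] [Module F V] [FiniteDimensional F V]

theorem finrank_inf_add_finrank_le {U E : Submodule F V} (hUE : U ≤ E) (X : Submodule F V) :
    finrank F ↥(E ⊓ X) + finrank F U ≤ finrank F ↥(U ⊓ X) + finrank F E := by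
  have h1 := Submodule.finrank_sup_add_finrank_inf_eq (E ⊓ X) U
  have h2 : finrank F ↥(E ⊓ X ⊔ U) ≤ finrank F E :=
    Submodule.finrank_mono (sup_le inf_le_left hUE)
  have h3 : E ⊓ X ⊓ U = U ⊓ X := by rw [inf_right_comm, inf_eq_right.2 hUE]
  rw [h3] at h1
  omega

theorem exists_finrank_eq_succ_between {U W : Submodule F V} (hUW : ¬ W ≤ U) :
    ∃ E : Submodule F V, U ≤ E ∧ E ≤ U ⊔ W ∧ finrank F E = finrank F U + 1 := by
  obtain ⟨v, hvW, hvU⟩ := SetLike.not_le_iff_exists.1 hUW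
  have hv : F ∙ v ≤ W := (Submodule.span_singleton_le_iff_mem v W).2 hvW
  refine ⟨U ⊔ F ∙ v, le_sup_left, sup_le_sup_left hv U, le_antisymm ?_ ?_⟩
  · refine (Submodule.finrank_add_le_finrank_add_finrank _ _).trans ?_
    exact Nat.add_le_add_left ((finrank_span_le_card _).trans (by simp)) _
  · refine Submodule.finrank_lt_finrank_of_lt (le_sup_left.lt_of_ne fun heq => hvU ?_)
    rw [heq]
    exact Submodule.mem_sup_right (Submodule.mem_span_singleton_self v)

end Dimension

section CoveringCode

variable {F : Type} [Field F] {n k δ h : ℕ} {C : Finset (Submodule F (Fin n → F))}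

theorem IsCoveringCode.finrank_inf_sup_add_lt (hC : IsCoveringCode F n k δ 3 C)
    (hh : 2 * k + 1 ≤ 2 * h + δ) {U V W : Submodule F (Fin n → F)}
    (hU : U ∈ C) (hV : V ∈ C) (hW : W ∈ C) (hUV : U ≠ V) (hUW : U ≠ W) (hVW : V ≠ W) :
    finrank F ↥(U ⊓ (V ⊔ W)) + finrank F ↥(V ⊓ W) < 2 * h := by
  classical
  have h1 := hC.2 {U, V, W} (by simp [Finset.insert_subset_iff, hU, hV, hW])
    (Finset.card_eq_three.2 ⟨U, V, W, hUV, hUW, hVW, rfl⟩)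
  rw [Finset.sup_insert, Finset.sup_insert, Finset.sup_singleton] at h1
  simp only [id] at h1
  have h2 := Submodule.finrank_sup_add_finrank_inf_eq U (V ⊔ W)
  have h3 := Submodule.finrank_sup_add_finrank_inf_eq V W
  rw [hC.1 U hU] at h2
  rw [hC.1 V hV, hC.1 W hW] at h3
  omega

/-- `E` enlarges the codeword `U` by one dimension inside the span of `U` and another codeword
meeting `U` in dimension more than `h`, if there is one, and is `U` otherwise. -/
def IsEnlargement (C : Finset (Submodule F (Fin n → F))) (h : ℕ)
    (U E : Submodule F (Fin n → F)) : Prop :=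
  (E = U ∧ ∀ V ∈ C, V ≠ U → finrank F ↥(U ⊓ V) ≤ h) ∨
  (U ≤ E ∧ finrank F E = finrank F U + 1 ∧
    ∃ V ∈ C, V ≠ U ∧ h < finrank F ↥(U ⊓ V) ∧ E ≤ U ⊔ V)

theorem IsCoveringCode.exists_isEnlargement (hC : IsCoveringCode F n k δ 3 C)
    {U : Submodule F (Fin n → F)} (hU : U ∈ C) : ∃ E, IsEnlargement C h U E := by
  by_cases hex : ∃ V ∈ C, V ≠ U ∧ h < finrank F ↥(U ⊓ V)
  · obtain ⟨V, hV, hVU, hd⟩ := hex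
    have hnle : ¬ V ≤ U := fun hle =>
      hVU (Submodule.eq_of_le_of_finrank_eq hle ((hC.1 V hV).trans (hC.1 U hU).symm))
    obtain ⟨E, hUE, hE, hrank⟩ := exists_finrank_eq_succ_between hnle
    exact ⟨E, Or.inr ⟨hUE, hrank, V, hV, hVU, hd, hE⟩⟩
  · push Not at hex
    exact ⟨U, Or.inl ⟨rfl, hex⟩⟩

/-- If the codewords `U` and `V` meet in dimension less than `h`, then `U` meets a proper
enlargement of `V` in dimension less than `h - 1`. -/
theorem IsCoveringCode.finrank_inf_enlargement (hC : IsCoveringCode F n k δ 3 C)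
    (hh : 2 * k + 1 ≤ 2 * h + δ) {U V E : Submodule F (Fin n → F)} (hU : U ∈ C) (hV : V ∈ C)
    (hUV : U ≠ V) (hd : finrank F ↥(U ⊓ V) < h) (hE : IsEnlargement C h V E) :
    E = V ∨ (finrank F E = finrank F V + 1 ∧ finrank F ↥(U ⊓ E) + 1 < h) := by
  rcases hE with ⟨rfl, -⟩ | ⟨hVE, hrank, W, hW, hWV, hVW, hE⟩
  · exact Or.inl rfl
  · refine Or.inr ⟨hrank, ?_⟩
    have hUW : U ≠ W := by
      rintro rfl
      rw [inf_comm] at hd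
      omega
    have h1 := hC.finrank_inf_sup_add_lt hh hU hV hW hUV hUW hWV.symm
    have h2 : finrank F ↥(U ⊓ E) ≤ finrank F ↥(U ⊓ (V ⊔ W)) :=
      Submodule.finrank_mono (inf_le_inf_left U hE)
    omega

theorem IsCoveringCode.finrank_enlargement_inf_lt (hC : IsCoveringCode F n k δ 3 C)
    (hh : 2 * k + 1 ≤ 2 * h + δ) {U V D E : Submodule F (Fin n → F)} (hU : U ∈ C) (hV : V ∈ C)
    (hUV : U ≠ V) (hd : finrank F ↥(U ⊓ V) < h) (hD : IsEnlargement C h U D)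
    (hE : IsEnlargement C h V E) : finrank F ↥(D ⊓ E) < h := by
  have hd' : finrank F ↥(V ⊓ U) < h := by rwa [inf_comm]
  rcases hC.finrank_inf_enlargement hh hV hU hUV.symm hd' hD with rfl | ⟨hD1, hD2⟩
  · rcases hC.finrank_inf_enlargement hh hU hV hUV hd hE with rfl | ⟨-, hE2⟩
    · exact hd
    · omega
  · rcases hC.finrank_inf_enlargement hh hU hV hUV hd hE with rfl | ⟨-, hE2⟩
    · rw [inf_comm]
      omega
    · have hUD : U ≤ D := by
        rcases hD with ⟨rfl, -⟩ | ⟨hUD, -⟩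
        · rfl
        · exact hUD
      have := finrank_inf_add_finrank_le hUD E
      omega

theorem IsCoveringCode.eq_of_le_finrank_inf (hC : IsCoveringCode F n k δ 3 C)
    (hh : 2 * k + 1 ≤ 2 * h + δ) {U V W : Submodule F (Fin n → F)}
    (hU : U ∈ C) (hV : V ∈ C) (hW : W ∈ C) (hVU : V ≠ U) (hWU : W ≠ U)
    (hV' : h ≤ finrank F ↥(U ⊓ V)) (hW' : h ≤ finrank F ↥(U ⊓ W)) : V = W := by
  by_contra hVW
  have h1 := hC.finrank_inf_sup_add_lt hh hW hU hV hWU (Ne.symm hVW) hVU.symm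
  have h2 : finrank F ↥(U ⊓ W) ≤ finrank F ↥(W ⊓ (U ⊔ V)) :=
    Submodule.finrank_mono (le_inf inf_le_right (inf_le_left.trans le_sup_left))
  omega

theorem IsCoveringCode.card_mul_le [Fintype F] (hC : IsCoveringCode F n k δ 3 C)
    (hh : 2 * k + 1 ≤ 2 * h + δ) (hh1 : 1 ≤ h) (hhk : h ≤ k) (hkn : k ≤ n) :
    (C.card : ℚ) * (2 * gaussBinom (Fintype.card F) k h - 1) ≤
      2 * gaussBinom (Fintype.card F) n h := by
  classical
  have hex (U : Submodule F (Fin n → F)) : ∃ E, U ∈ C → IsEnlargement C h U E := by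
    by_cases hU : U ∈ C
    · exact (hC.exists_isEnlargement hU).imp fun E hE _ => hE
    · exact ⟨U, fun hU' => absurd hU' hU⟩
  choose E hE using hex
  have hsum := sum_subspaceCount_le h C E
  have htop : (subspaceCount h (⊤ : Submodule F (Fin n → F)) : ℚ) =
      gaussBinom (Fintype.card F) n h := by
    rw [subspaceCount_eq_gaussBinom] <;> simp [hhk.trans hkn]
  have hterm (U) (hU : U ∈ C) : 2 * gaussBinom (Fintype.card F) k h - 1 ≤
      2 * (subspaceCount h (E U) : ℚ) -
        ∑ V ∈ C.erase U, (subspaceCount h (E U ⊓ E V) : ℚ) := by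
    have hUk := hC.1 U hU
    have hcU : (subspaceCount h U : ℚ) = gaussBinom (Fintype.card F) k h := by
      rw [subspaceCount_eq_gaussBinom (hUk ▸ hhk), hUk]
    have hzero (V) (hV : V ∈ C) (hVU : V ≠ U) (hd : finrank F ↥(U ⊓ V) < h) :
        (subspaceCount h (E U ⊓ E V) : ℚ) = 0 := by
      rw [subspaceCount_eq_zero (hC.finrank_enlargement_inf_lt hh hU hV hVU.symm hd
        (hE U hU) (hE V hV)), Nat.cast_zero]
    -- at most one summand is nonzero
    have hsum_le {c : ℚ} (hc : 0 ≤ c)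
        (hle : ∀ V ∈ C, V ≠ U → (subspaceCount h (E U ⊓ E V) : ℚ) ≤ c) :
        ∑ V ∈ C.erase U, (subspaceCount h (E U ⊓ E V) : ℚ) ≤ c := by
      by_cases hp : ∃ V ∈ C, V ≠ U ∧ h ≤ finrank F ↥(U ⊓ V)
      · obtain ⟨V, hV, hVU, hd⟩ := hp
        rw [Finset.sum_eq_single_of_mem V (Finset.mem_erase.2 ⟨hVU, hV⟩)]
        · exact hle V hV hVU
        · intro W hW hWV
          obtain ⟨hWU, hW⟩ := Finset.mem_erase.1 hW
          refine hzero W hW hWU (lt_of_not_ge fun hd' => hWV ?_)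
          exact hC.eq_of_le_finrank_inf hh hU hW hV hWU hVU hd' hd
      · push Not at hp
        rw [Finset.sum_eq_zero fun V hV => ?_]
        · exact hc
        · obtain ⟨hVU, hV⟩ := Finset.mem_erase.1 hV
          exact hzero V hV hVU (hp V hV hVU)
    rcases hE U hU with ⟨hEU, hle⟩ | ⟨-, hrank, -⟩
    · have := hsum_le zero_le_one fun V hV hVU => by
        by_cases hd : finrank F ↥(U ⊓ V) < h
        · rw [hzero V hV hVU hd]
          exact zero_le_one
        · have hEV : E V = V := by
            rcases hE V hV with ⟨hEV, -⟩ | ⟨-, -, W, hW, hWV, hVW, -⟩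
            · exact hEV
            · have hd' : h ≤ finrank F ↥(V ⊓ U) := by
                rw [inf_comm]
                omega
              obtain rfl := hC.eq_of_le_finrank_inf hh hV hW hU hWV hVU.symm hVW.le hd'
              rw [inf_comm] at hVW
              exact absurd (hle V hV hVU) hVW.not_ge
          rw [hEU, hEV]
          exact_mod_cast subspaceCount_le_one (hle V hV hVU)
      rw [hEU] at this ⊢
      linarith
    · have := hsum_le (Nat.cast_nonneg (subspaceCount h (E U))) fun V _ _ => by
        exact_mod_cast subspaceCount_mono inf_le_left
      rw [hUk] at hrank
      have hcE : (subspaceCount h (E U) : ℚ) = gaussBinom (Fintype.card F) (k + 1) h := by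
        rw [subspaceCount_eq_gaussBinom (by omega), hrank]
      have := two_mul_gaussBinom_le (q := Fintype.card F) Fintype.one_lt_card hh1 hhk
      linarith
  calc (C.card : ℚ) * (2 * gaussBinom (Fintype.card F) k h - 1)
      = ∑ _U ∈ C, (2 * gaussBinom (Fintype.card F) k h - 1) := by
        rw [Finset.sum_const, nsmul_eq_mul]
    _ ≤ _ := Finset.sum_le_sum hterm
    _ ≤ 2 * gaussBinom (Fintype.card F) n h := by
        rw [← htop]
        exact_mod_cast hsum

end CoveringCode

theorem gaussBinom_nonneg {q m h : ℕ} (hq : 1 ≤ q) (hm : h ≤ m) : 0 ≤ gaussBinom q m h := by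
  have hq' : (1 : ℚ) ≤ q := by exact_mod_cast hq
  refine Finset.prod_nonneg fun i hi => ?_
  have hi' := Finset.mem_range.1 hi
  exact div_nonneg (sub_nonneg.2 (pow_le_pow_right₀ hq' (hi'.le.trans hm)))
    (sub_nonneg.2 (pow_le_pow_right₀ hq' hi'.le))

/-- For `δ ≤ 2k` and `h = ⌊k + 1 - δ/2⌋`, every `3`-`(n,k,δ)_q^c`
code `C` satisfies `|C|·[k,h]_q·(2[k,h]_q − 1) ≤ 2[k,h]_q·[n,h]_q`, i.e.
`B_q(n,k,δ;3) ≤ (1 + 1/(2[k,h]_q − 1))·[n,h]_q/[k,h]_q`. -/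
theorem stmt_4 (q n k δ h : ℕ) (F : Type) [Field F] [Fintype F]
    (hq : Fintype.card F = q) (hq' : IsPrimePow q)
    (hk : 1 ≤ k) (hkn : k < n) (hδ : 1 ≤ δ) (hδk : δ ≤ 2 * k)
    (hh : (h : ℤ) = ⌊(k : ℚ) + 1 - (δ : ℚ) / 2⌋)
    (C : Finset (Submodule F (Fin n → F))) (hC : IsCoveringCode F n k δ 3 C) :
    (C.card : ℚ) * gaussBinom q k h * (2 * gaussBinom q k h - 1) ≤
      2 * gaussBinom q k h * gaussBinom q n h := by
  subst hq
  obtain ⟨hle, hlt⟩ := Int.floor_eq_iff.1 hh.symm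
  push_cast at hle hlt
  have h1 : 2 * h + δ ≤ 2 * k + 2 := by
    have : (2 * h + δ : ℚ) ≤ 2 * k + 2 := by linarith
    exact_mod_cast this
  have h2 : 2 * k < 2 * h + δ := by
    have : (2 * k : ℚ) < 2 * h + δ := by linarith
    exact_mod_cast this
  have hmain := hC.card_mul_le h2 (by omega) (by omega) hkn.le
  have hnn : 0 ≤ gaussBinom (Fintype.card F) k h :=
    gaussBinom_nonneg Fintype.card_pos (by omega)
  calc (C.card : ℚ) * gaussBinom (Fintype.card F) k h * (2 * gaussBinom (Fintype.card F) k h - 1)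
      = gaussBinom (Fintype.card F) k h *
          (C.card * (2 * gaussBinom (Fintype.card F) k h - 1)) := by ring
    _ ≤ gaussBinom (Fintype.card F) k h * (2 * gaussBinom (Fintype.card F) n h) := by gcongr
    _ = 2 * gaussBinom (Fintype.card F) k h * gaussBinom (Fintype.card F) n h := by ring
end

section
/- Let q be a prime power and let k, δ, α be positive integers with α ≥ 3 and δ ≥ (α−1)(k−1). Then there exists a constant c > 0, depending only on q, k, δ and α, such that for every n > k, every α-(n,k,δ)_q^c covering Grassmannian code C satisfies |C| ≤ c · q^{(1 + 1/⌊α/2⌋)·n}. -/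
open Module

section IncidenceWalks

variable {P E : Type*}

/-- `IsIncidenceWalk I v w l`: the list `l` of pairs (edge, next point) describes a walk from `w`
to `v` in the incidence structure `I` in which consecutive points differ and consecutive
edges differ. -/
def IsIncidenceWalk (I : P → E → Prop) (v : P) : P → List (E × P) → Prop
  | w, [] => w = v
  | w, a :: l => I w a.1 ∧ I a.2 a.1 ∧ w ≠ a.2 ∧ (∀ b ∈ l.head?, b.1 ≠ a.1) ∧
      IsIncidenceWalk I v a.2 l

variable {I : P → E → Prop} {v : P} {N : ℕ}

theorem IsIncidenceWalk.false_of_head_ne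
    (hclosed : ∀ l : List (E × P), l ≠ [] → l.length ≤ N → ¬ IsIncidenceWalk I v v l)
    (l₁ l₂ : List (E × P)) (w : P) (h₁ : IsIncidenceWalk I v w l₁)
    (h₂ : IsIncidenceWalk I v w l₂)
    (hne : ∀ a ∈ l₁.head?, ∀ b ∈ l₂.head?, b.1 ≠ a.1)
    (hpos : 0 < l₁.length + l₂.length) (hN : l₁.length + l₂.length ≤ N) : False := by
  induction l₁ generalizing l₂ w with
  | nil =>
    obtain rfl : w = v := h₁
    refine hclosed l₂ ?_ (by simpa using hN) h₂
    rintro rfl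
    simp at hpos
  | cons a l ih =>
    obtain ⟨h1, h2, h3, h4, h5⟩ := h₁
    refine ih ((a.1, w) :: l₂) a.2 h5 ⟨h2, h1, h3.symm, hne a (by simp), h₂⟩ ?_ (by simp) ?_
    · intro b hb c hc
      obtain rfl : (a.1, w) = c := by simpa using hc
      exact (h4 b hb).symm
    · simp only [List.length_cons] at hN ⊢
      omega

theorem IsIncidenceWalk.eq_of_closed
    (hclosed : ∀ l : List (E × P), l ≠ [] → l.length ≤ N → ¬ IsIncidenceWalk I v v l)
    (l₁ l₂ : List (E × P)) (w : P) (h₁ : IsIncidenceWalk I v w l₁)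
    (h₂ : IsIncidenceWalk I v w l₂) (hN : l₁.length + l₂.length ≤ N) : l₁ = l₂ := by
  induction l₁ generalizing l₂ w with
  | nil =>
    by_contra hne
    refine false_of_head_ne hclosed [] l₂ w h₁ h₂ (by simp) ?_ hN
    simpa [List.length_pos_iff] using Ne.symm hne
  | cons a l ih =>
    cases l₂ with
    | nil => exact (false_of_head_ne hclosed _ _ w h₁ h₂ (by simp) (by simp) hN).elim
    | cons b m =>
      by_cases hab : b.1 = a.1
      · have h₁' := h₁
        have h₂' := h₂
        obtain ⟨h1, h2, h3, h4, h5⟩ := h₁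
        obtain ⟨g1, g2, g3, g4, g5⟩ := h₂
        simp only [List.length_cons] at hN
        by_cases hy : a.2 = b.2
        · rw [← hy] at g5
          rw [ih m a.2 h5 g5 (by omega), Prod.ext hab.symm hy]
        · refine (false_of_head_ne hclosed l ((a.1, b.2) :: m) a.2 h5
            ⟨h2, hab ▸ g2, hy, hab ▸ g4, g5⟩ ?_ (by simp) ?_).elim
          · intro c hc e he
            obtain rfl : (a.1, b.2) = e := by simpa using he
            exact (h4 c hc).symm
          · simp only [List.length_cons]
            omega
      · refine (false_of_head_ne hclosed _ _ w h₁ h₂ ?_ (by simp) hN).elim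
        simpa using hab

open Classical in
/-- If every point on an edge lies on more than `d` edges and every edge has at least two points,
then there are at least `d ^ s` non-backtracking walks of length `s` ending at a given point. -/
theorem exists_incidenceWalks {C : Finset E} {d : ℕ}
    (hdeg : ∀ p, (∃ U, I p U) → d < (C.filter (I p)).card)
    (htwo : ∀ p U, I p U → ∃ p', I p' U ∧ p' ≠ p) (hv : ∃ U, I v U) (s : ℕ) :
    ∃ W : Finset (P × List (E × P)), d ^ s ≤ W.card ∧
      ∀ x ∈ W, x.2.length = s ∧ IsIncidenceWalk I v x.1 x.2 := by
  choose! f hf using htwo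
  induction s with
  | zero => exact ⟨{(v, [])}, by simp, by simp [IsIncidenceWalk]⟩
  | succ s ih =>
    obtain ⟨W, hcard, hW⟩ := ih
    let extensions : P × List (E × P) → Finset E := fun x =>
      (C.filter (I x.1)).filter fun U => ∀ b ∈ x.2.head?, b.1 ≠ U
    have hext : ∀ x ∈ W, d ≤ (extensions x).card := by
      rintro ⟨w, l⟩ hx
      obtain ⟨-, hw⟩ := hW _ hx
      cases l with
      | nil =>
        obtain rfl : w = v := hw
        simpa [extensions] using (hdeg w hv).le
      | cons a l =>
        have h := hdeg w ⟨a.1, hw.1⟩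
        have : (C.filter (I w)).erase a.1 ⊆ extensions (w, a :: l) := by
          intro U hU
          simp only [Finset.mem_erase, Finset.mem_filter] at hU
          simp only [extensions, Finset.mem_filter, List.head?_cons, Option.mem_def,
            Option.some.injEq,
            forall_eq']
          exact ⟨hU.2, hU.1.symm⟩
        have h' := Finset.pred_card_le_card_erase (s := C.filter (I w)) (a := a.1)
        have := Finset.card_le_card this
        omega
    let g : (Σ _ : P × List (E × P), E) → P × List (E × P) := fun y =>
      (f y.1.1 y.2, (y.2, y.1.1) :: y.1.2)
    have hg : Function.Injective g := by
      rintro ⟨⟨w, l⟩, U⟩ ⟨⟨w', l'⟩, U'⟩ h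
      simp only [g, Prod.mk.injEq, List.cons.injEq] at h
      obtain ⟨-, ⟨rfl, rfl⟩, rfl⟩ := h
      rfl
    refine ⟨(W.sigma extensions).image g, ?_, ?_⟩
    · rw [Finset.card_image_of_injective _ hg, Finset.card_sigma, pow_succ]
      calc d ^ s * d ≤ W.card * d := Nat.mul_le_mul_right _ hcard
        _ = ∑ _x ∈ W, d := by simp
        _ ≤ _ := Finset.sum_le_sum hext
    · intro x hx
      obtain ⟨⟨⟨w, l⟩, U⟩, hy, rfl⟩ := Finset.mem_image.1 hx
      obtain ⟨hy1, hy2⟩ := Finset.mem_sigma.1 hy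
      obtain ⟨hlen, hwalk⟩ := hW _ hy1
      simp only [extensions, Finset.mem_filter] at hy2
      obtain ⟨⟨-, hIU⟩, hne⟩ := hy2
      obtain ⟨h1, h2⟩ := hf w U hIU
      exact ⟨by simpa [g] using hlen, h1, hIU, h2, hne, hwalk⟩

open Classical in
/-- A hypergraph with more than `d` edges per point contains a nonempty subhypergraph in which
every covered point lies on more than `d` edges. -/
theorem exists_subset_forall_degree_lt (r : P → E → Prop) (A : Finset P) (C : Finset E) (d : ℕ)
    (h : d * A.card < C.card) :
    ∃ C' ⊆ C, C'.Nonempty ∧ ∀ p ∈ A, (∃ U ∈ C', r p U) → d < (C'.filter (r p)).card := by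
  suffices H : ∀ C : Finset E, d * (A.filter fun p => ∃ U ∈ C, r p U).card < C.card →
      ∃ C' ⊆ C, C'.Nonempty ∧ ∀ p ∈ A, (∃ U ∈ C', r p U) → d < (C'.filter (r p)).card from
    H C ((Nat.mul_le_mul_left _ (Finset.card_filter_le _ _)).trans_lt h)
  clear h C
  intro C
  induction C using Finset.strongInduction with
  | H C ih =>
    intro h
    by_cases hall : ∀ p ∈ A, (∃ U ∈ C, r p U) → d < (C.filter (r p)).card
    · exact ⟨C, Finset.Subset.refl _, Finset.card_pos.1 (by omega), hall⟩
    push Not at hall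
    obtain ⟨p, hp, ⟨U, hU, hpU⟩, hle⟩ := hall
    have hsum := Finset.card_filter_add_card_filter_not (s := C) (r p)
    have hss : C.filter (fun V => ¬ r p V) ⊂ C :=
      Finset.filter_ssubset.2 ⟨U, hU, by simpa using hpU⟩
    have hlt : (A.filter fun p' => ∃ V ∈ C.filter (fun V => ¬ r p V), r p' V).card <
        (A.filter fun p' => ∃ V ∈ C, r p' V).card := by
      refine Finset.card_lt_card (Finset.ssubset_iff_of_subset ?_ |>.2
        ⟨p, Finset.mem_filter.2 ⟨hp, U, hU, hpU⟩, ?_⟩)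
      · intro p' hp'
        obtain ⟨h1, V, hV, h2⟩ := Finset.mem_filter.1 hp'
        exact Finset.mem_filter.2 ⟨h1, V, (Finset.mem_filter.1 hV).1, h2⟩
      · intro hp'
        obtain ⟨-, V, hV, h2⟩ := Finset.mem_filter.1 hp'
        exact (Finset.mem_filter.1 hV).2 h2
    obtain ⟨C', hC', hrest⟩ := ih _ hss (by
      have := Nat.mul_le_mul_left d (Nat.succ_le_of_lt hlt)
      rw [Nat.mul_succ] at this
      omega)
    exact ⟨C', hC'.trans hss.subset, hrest⟩

end IncidenceWalks

section Subspaces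

variable {F V : Type*} [Field F] [AddCommGroup V] [Module F V]

/-- Incidence of one-dimensional subspaces with the members of `C`. -/
def PointIncidence (C : Finset (Submodule F V)) (p U : Submodule F V) : Prop :=
  finrank F p = 1 ∧ U ∈ C ∧ p ≤ U

theorem exists_finrank_eq_one_le {U : Submodule F V} (hU : U ≠ ⊥) :
    ∃ p : Submodule F V, finrank F p = 1 ∧ p ≤ U := by
  obtain ⟨x, hx, hx0⟩ := Submodule.exists_mem_ne_zero_of_ne_bot hU
  exact ⟨Submodule.span F {x}, finrank_span_singleton hx0,
    (Submodule.span_singleton_le_iff_mem _ _).2 hx⟩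

theorem card_filter_finrank_eq_one_le [Fintype F] (n : ℕ)
    [Fintype (Submodule F (Fin n → F))] :
    (Finset.univ.filter fun p : Submodule F (Fin n → F) => finrank F p = 1).card ≤
      Fintype.card F ^ n := by
  classical
  calc _ ≤ (Finset.univ.image fun x : Fin n → F => Submodule.span F {x}).card := by
        refine Finset.card_le_card fun p hp => ?_
        obtain ⟨x, -, hx⟩ := finrank_eq_one_iff'.1 (Finset.mem_filter.1 hp).2
        refine Finset.mem_image.2 ⟨x, Finset.mem_univ _, le_antisymm ?_ fun y hy => ?_⟩
        · exact (Submodule.span_singleton_le_iff_mem _ _).2 x.2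
        · obtain ⟨c, hc⟩ := hx ⟨y, hy⟩
          exact Submodule.mem_span_singleton.2 ⟨c, congrArg Subtype.val hc⟩
    _ ≤ (Finset.univ : Finset (Fin n → F)).card := Finset.card_image_le
    _ = Fintype.card F ^ n := by simp

variable [FiniteDimensional F V]

theorem eq_of_finrank_eq_one_of_le {p p' X : Submodule F V} (hp : finrank F p = 1)
    (hp' : finrank F p' = 1) (hX : finrank F X ≤ 1) (h : p ≤ X) (h' : p' ≤ X) : p = p' :=
  (Submodule.eq_of_le_of_finrank_le h (hX.trans hp.ge)).trans
    (Submodule.eq_of_le_of_finrank_le h' (hX.trans hp'.ge)).symm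

variable {C : Finset (Submodule F V)} {k α : ℕ}

/-- If any `α` members of `C` are in general enough position and every covered point lies on at
least `α` members, then subfamilies with fewer than `α` members are in general position too. -/
theorem lt_finrank_sup_of_card_le (hk : 1 ≤ k) (hCk : ∀ U ∈ C, finrank F U = k)
    (hα : ∀ S ⊆ C, S.card = α → α * (k - 1) < finrank F ↥(S.sup id))
    (hext : ∀ S ⊆ C, S.Nonempty → S.card < α →
      ∃ p : Submodule F V, finrank F p = 1 ∧ p ≤ S.sup id ∧ ∃ U ∈ C, U ∉ S ∧ p ≤ U)
    (S : Finset (Submodule F V)) (hS : S ⊆ C) (hne : S.Nonempty) (hcard : S.card ≤ α) :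
    S.card * (k - 1) < finrank F ↥(S.sup id) := by
  classical
  induction hm : α - S.card generalizing S with
  | zero =>
    have : S.card = α := by omega
    rw [this]
    exact hα S hS this
  | succ m ih =>
    obtain ⟨p, hp1, hpS, U, hU, hUS, hpU⟩ := hext S hS hne (by omega)
    have h := ih (insert U S) (Finset.insert_subset hU hS) (by simp)
      (by rw [Finset.card_insert_of_notMem hUS]; omega)
      (by rw [Finset.card_insert_of_notMem hUS]; omega)
    rw [Finset.card_insert_of_notMem hUS, Finset.sup_insert, add_mul, one_mul] at h
    have hdim := Submodule.finrank_sup_add_finrank_inf_eq U (S.sup id)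
    have hle := Submodule.finrank_mono (le_inf hpU hpS)
    rw [hCk U hU] at hdim
    simp only [id] at h hdim
    omega

theorem IsIncidenceWalk.finrank_bounds (hk : 1 ≤ k) (hCk : ∀ U ∈ C, finrank F U = k)
    (hgen : ∀ S ⊆ C, S.Nonempty → S.card ≤ α → S.card * (k - 1) < finrank F ↥(S.sup id))
    [DecidableEq (Submodule F V)]
    (v w : Submodule F V) (l : List (Submodule F V × Submodule F V)) (hl : l.length ≤ α)
    (hw : IsIncidenceWalk (PointIncidence C) v w l) :
    (l.map Prod.fst).Nodup ∧ (∀ a ∈ l, a.1 ∈ C) ∧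
    (l ≠ [] → w ≤ (l.map Prod.fst).toFinset.sup id) ∧
    (l ≠ [] → v ≤ (l.map Prod.fst).toFinset.sup id) ∧
    finrank F ↥((l.map Prod.fst).toFinset.sup id) ≤ l.length * (k - 1) + 1 ∧
    ∀ a m, l = a :: m → finrank F ↥(a.1 ⊓ (m.map Prod.fst).toFinset.sup id) ≤ 1 := by
  induction l generalizing w with
  | nil =>
    refine ⟨by simp, by simp, by simp, by simp, ?_, by simp⟩
    rw [List.map_nil, List.toFinset_nil, Finset.sup_empty, finrank_bot]
    omega
  | cons a m ih =>
    obtain ⟨⟨hw1, haC, hwa⟩, ⟨ha1, -, haa⟩, hwne, hhead, hm⟩ := hw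
    obtain ⟨hnd, hmC, hfst, hlst, hfin, hinf⟩ := ih a.2 (by simp at hl; omega) hm
    set X := (m.map Prod.fst).toFinset.sup id with hX
    have hsup : ((a :: m).map Prod.fst).toFinset.sup id = a.1 ⊔ X := by
      rw [List.map_cons, List.toFinset_cons, Finset.sup_insert, id]
    have hle : ∀ c ∈ m, c.1 ≤ X := fun c hc =>
      Finset.le_sup (f := id) (List.mem_toFinset.2 (List.mem_map_of_mem hc))
    have hnotin : a.1 ∉ m.map Prod.fst := by
      intro hmem
      obtain ⟨c, hc, hca⟩ := List.mem_map.1 hmem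
      cases m with
      | nil => simp at hc
      | cons b m' =>
        have hba : b.1 ≠ a.1 := hhead b (by simp)
        obtain ⟨⟨-, -, h1⟩, ⟨h2, -, h3⟩, h4, -, h5⟩ := hm
        have hcm : c ∈ m' := by
          rcases List.mem_cons.1 hc with rfl | h
          · exact absurd hca hba
          · exact h
        have hle' : ∀ c ∈ m', c.1 ≤ (m'.map Prod.fst).toFinset.sup id := fun c hc =>
          Finset.le_sup (f := id) (List.mem_toFinset.2 (List.mem_map_of_mem hc))
        refine h4 (eq_of_finrank_eq_one_of_le ha1 h2 (hinf b m' rfl) (le_inf h1 ?_)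
          (le_inf h3 ?_))
        · exact (haa.trans hca.ge).trans (hle' c hcm)
        · cases m' with
          | nil => simp at hcm
          | cons e m'' => exact h5.1.2.2.trans (hle' e (by simp))
    have hnodup : ((a :: m).map Prod.fst).Nodup := by
      rw [List.map_cons]
      exact List.nodup_cons.2 ⟨hnotin, hnd⟩
    have hallC : ∀ c ∈ a :: m, c.1 ∈ C := by
      intro c hc
      rcases List.mem_cons.1 hc with rfl | h
      · exact haC
      · exact hmC c h
    have hlow := hgen ((a :: m).map Prod.fst).toFinset
      (by
        intro U hU
        obtain ⟨c, hc, rfl⟩ := List.mem_map.1 (List.mem_toFinset.1 hU)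
        exact hallC c hc)
      ⟨a.1, by simp⟩
      (by rw [List.toFinset_card_of_nodup hnodup, List.length_map]; exact hl)
    rw [List.toFinset_card_of_nodup hnodup, List.length_map, hsup, List.length_cons, add_mul,
      one_mul] at hlow
    have hdim := Submodule.finrank_sup_add_finrank_inf_eq a.1 X
    rw [hCk _ haC] at hdim
    refine ⟨hnodup, hallC, fun _ => hsup ▸ le_sup_of_le_left hwa, fun _ => ?_, ?_, ?_⟩
    · rw [hsup]
      by_cases hm0 : m = []
      · subst hm0
        obtain rfl : a.2 = v := hm
        exact le_sup_of_le_left haa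
      · exact le_sup_of_le_right (hlst hm0)
    · rw [hsup, List.length_cons, add_mul, one_mul]
      by_cases hm0 : m = []
      · subst hm0
        have : X = ⊥ := by simp [hX]
        rw [this, sup_bot_eq, hCk _ haC]
        omega
      · have := Submodule.finrank_mono (le_inf haa (hfst hm0))
        omega
    · rintro b m' h
      obtain ⟨rfl, rfl⟩ := List.cons.inj h
      rw [← hX]
      omega

theorem not_isIncidenceWalk_closed (hk : 1 ≤ k) (hCk : ∀ U ∈ C, finrank F U = k)
    (hgen : ∀ S ⊆ C, S.Nonempty → S.card ≤ α → S.card * (k - 1) < finrank F ↥(S.sup id))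
    (v : Submodule F V) (l : List (Submodule F V × Submodule F V)) (hne : l ≠ [])
    (hl : l.length ≤ α) : ¬ IsIncidenceWalk (PointIncidence C) v v l := by
  classical
  intro hw
  cases l with
  | nil => exact hne rfl
  | cons a m =>
    obtain ⟨-, -, -, -, -, hinf⟩ := hw.finrank_bounds hk hCk hgen v v _ hl
    obtain ⟨⟨hv1, -, hva⟩, ⟨ha1, -, haa⟩, hvne, -, hm⟩ := hw
    obtain ⟨-, -, hfst, hlst, -, -⟩ :=
      hm.finrank_bounds hk hCk hgen v a.2 m (by simp at hl; omega)
    by_cases hm0 : m = []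
    · subst hm0
      exact hvne hm.symm
    · exact hvne (eq_of_finrank_eq_one_of_le hv1 ha1 (hinf a m rfl)
        (le_inf hva (hlst hm0)) (le_inf haa (hfst hm0)))

end Subspaces

/-- A Moore-type bound: a covering code whose size exceeds `d` times the number of points forces
at least `d ^ ⌊α/2⌋` points. -/
theorem IsCoveringCode.card_le_mul {F : Type} [Field F] [Fintype F] {n k δ α d : ℕ} (hk : 2 ≤ k)
    (hα : 1 ≤ α) (hδk : (α - 1) * (k - 1) ≤ δ) (hαd : α ≤ d)
    (hd : Fintype.card F ^ n < d ^ (α / 2))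
    {C : Finset (Submodule F (Fin n → F))} (hC : IsCoveringCode F n k δ α C) :
    C.card ≤ d * Fintype.card F ^ n := by
  classical
  have : Fintype (Submodule F (Fin n → F)) := Fintype.ofFinite _
  have hpts := card_filter_finrank_eq_one_le (F := F) n
  set A := Finset.univ.filter fun p : Submodule F (Fin n → F) => finrank F p = 1
  by_contra! hlt
  obtain ⟨C', hC', ⟨U₀, hU₀⟩, hdeg⟩ := exists_subset_forall_degree_lt
    (fun p U : Submodule F (Fin n → F) => p ≤ U) A C d
    ((Nat.mul_le_mul_left _ hpts).trans_lt hlt)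
  have hCk : ∀ U ∈ C', finrank F U = k := fun U hU => hC.1 U (hC' hU)
  have hpoint : ∀ U ∈ C', ∃ p : Submodule F (Fin n → F), finrank F p = 1 ∧ p ≤ U := by
    intro U hU
    refine exists_finrank_eq_one_le ?_
    rintro rfl
    have := hCk _ hU
    rw [finrank_bot] at this
    omega
  have hgen : ∀ S ⊆ C', S.Nonempty → S.card ≤ α →
      S.card * (k - 1) < finrank F ↥(S.sup id) := by
    refine lt_finrank_sup_of_card_le (by omega) hCk ?_ ?_
    · intro S hS hcard
      have h := hC.2 S (hS.trans hC') hcard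
      obtain ⟨a, rfl⟩ : ∃ a, α = a + 1 := ⟨α - 1, by omega⟩
      rw [Nat.add_sub_cancel] at hδk
      rw [add_mul, one_mul]
      omega
    · rintro S hS ⟨U, hU⟩ hcard
      obtain ⟨p, hp, hpU⟩ := hpoint U (hS hU)
      have h := hdeg p (by simpa [A] using hp) ⟨U, hS hU, hpU⟩
      obtain ⟨T, hT, hTS⟩ := Finset.exists_mem_notMem_of_card_lt_card
        ((hcard.trans_le hαd).trans h)
      obtain ⟨hT1, hT2⟩ := Finset.mem_filter.1 hT
      exact ⟨p, hp, hpU.trans (Finset.le_sup (f := id) hU), T, hT1, hTS, hT2⟩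
  obtain ⟨v, hv, hvU⟩ := hpoint U₀ hU₀
  obtain ⟨W, hWcard, hW⟩ := exists_incidenceWalks (I := PointIncidence C') (v := v) (C := C')
    (d := d)
    (by
      rintro p ⟨U, hp, hU, hpU⟩
      refine (hdeg p (by simpa [A] using hp) ⟨U, hU, hpU⟩).trans_le
        (Finset.card_le_card fun T hT => ?_)
      obtain ⟨hT1, hT2⟩ := Finset.mem_filter.1 hT
      exact Finset.mem_filter.2 ⟨hT1, hp, hT1, hT2⟩)
    (by
      rintro p U ⟨hp, hU, hpU⟩
      have hlt : p < U := lt_of_le_of_ne hpU (by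
        rintro rfl
        have := hCk _ hU
        omega)
      obtain ⟨x, hxU, hxp⟩ := SetLike.exists_of_lt hlt
      have hx0 : x ≠ 0 := by
        rintro rfl
        exact hxp p.zero_mem
      refine ⟨Submodule.span F {x}, ⟨finrank_span_singleton hx0, hU,
        (Submodule.span_singleton_le_iff_mem _ _).2 hxU⟩, ?_⟩
      rintro rfl
      exact hxp (Submodule.mem_span_singleton_self x))
    ⟨U₀, hv, hU₀, hvU⟩ (α / 2)
  have hmaps : ∀ x ∈ W, x.1 ∈ A := by
    rintro ⟨w, l⟩ hx
    have h := (hW _ hx).2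
    cases l with
    | nil =>
      obtain rfl : w = v := h
      simpa [A] using hv
    | cons a l => simpa [A] using h.1.1
  have hinj : Set.InjOn Prod.fst (SetLike.coe W) := by
    rintro ⟨w, l⟩ hx ⟨w', l'⟩ hx' (rfl : w = w')
    obtain ⟨hl, hw⟩ := hW _ hx
    obtain ⟨hl', hw'⟩ := hW _ hx'
    rw [IsIncidenceWalk.eq_of_closed (N := α)
      (fun l h1 h2 => not_isIncidenceWalk_closed (by omega) hCk hgen v l h1 h2) l l' w hw hw'
      (by simp only at hl hl'; omega)]
  have := Finset.card_le_card_of_injOn Prod.fst hmaps hinj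
  omega

/-- If `α ≥ 3` and `δ ≥ (α−1)(k−1)`, then there is a constant
`c > 0` depending only on `q, k, δ, α` such that every `α`-`(n,k,δ)_q^c` code has
cardinality at most `c · q^((1 + 1/⌊α/2⌋)·n)`. -/
theorem stmt_5 (q k δ α : ℕ) (F : Type) [Field F] [Fintype F]
    (hq : Fintype.card F = q) (hq' : IsPrimePow q)
    (hk : 1 ≤ k) (hδ : 1 ≤ δ) (hα : 3 ≤ α)
    (hδk : (α - 1) * (k - 1) ≤ δ) :
    ∃ c : ℝ, 0 < c ∧ ∀ n : ℕ, k < n →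
      ∀ C : Finset (Submodule F (Fin n → F)), IsCoveringCode F n k δ α C →
        (C.card : ℝ) ≤ c * (q : ℝ) ^ ((1 + 1 / ((α / 2 : ℕ) : ℝ)) * (n : ℝ)) := by
  subst hq
  refine ⟨α + 2, by positivity, fun n hn C hC => ?_⟩
  have ht : 0 < α / 2 := by omega
  set t := α / 2
  set Q : ℝ := (Fintype.card F : ℝ) ^ n with hQ
  have hF : 0 < Fintype.card F := Fintype.card_pos
  have hQ1 : 1 ≤ Q := one_le_pow₀ (by exact_mod_cast hF)
  have hQ0 : 0 < Q := by linarith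
  set R : ℝ := Q ^ (1 / (t : ℝ)) with hR
  have hR1 : 1 ≤ R := Real.one_le_rpow hQ1 (by positivity)
  have hpow : (Fintype.card F : ℝ) ^ ((1 + 1 / (t : ℝ)) * (n : ℝ)) = Q * R := by
    rw [mul_comm, Real.rpow_mul (by positivity), Real.rpow_natCast, ← hQ,
      Real.rpow_add hQ0, Real.rpow_one]
  rw [hpow]
  rcases hk.eq_or_lt with rfl | hk2
  · have : Fintype (Submodule F (Fin n → F)) := Fintype.ofFinite _
    have hle : C.card ≤ Fintype.card F ^ n :=
      (Finset.card_le_card fun U hU => by simpa using hC.1 U hU).trans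
        (card_filter_finrank_eq_one_le (F := F) n)
    have hle' : (C.card : ℝ) ≤ Q := by
      rw [hQ]
      exact_mod_cast hle
    have : 1 ≤ (α + 2 : ℝ) * R := by
      have : (0 : ℝ) ≤ α := by positivity
      nlinarith
    nlinarith
  · set d := ⌈R⌉₊ + α
    have hRd : R < d := by
      have h1 := Nat.le_ceil R
      have h2 : (3 : ℝ) ≤ α := by exact_mod_cast hα
      simp only [d]
      push_cast
      linarith
    have hRt : R ^ t = Q := by
      rw [hR, one_div, Real.rpow_inv_natCast_pow hQ0.le ht.ne']
    have hd : Fintype.card F ^ n < d ^ t := by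
      have : Q < (d : ℝ) ^ t := hRt ▸ pow_lt_pow_left₀ hRd (by linarith) ht.ne'
      rw [hQ] at this
      exact_mod_cast this
    have hle := hC.card_le_mul hk2 (by omega) hδk (by omega : α ≤ d) hd
    have hle' : (C.card : ℝ) ≤ d * Q := by
      rw [hQ]
      exact_mod_cast hle
    have hdle : (d : ℝ) ≤ (α + 2) * R := by
      have h1 := (Nat.ceil_lt_add_one (by linarith : 0 ≤ R)).le
      have h2 : (0 : ℝ) ≤ α := by positivity
      simp only [d]
      push_cast
      nlinarith
    nlinarith
end

section
/- Let q be a prime power and let n, k, δ, α be positive integers with 1 ≤ k < n, 3 ≤ α ≤ [k choose 1]_q and δ ≥ (α−1)(k−1) + 1. Then B_q(n,k,δ;α) ≤ (α−1) · [n choose 1]_q / ([k choose 1]_q + 1); that is, every α-(n,k,δ)_q^c covering Grassmannian code C satisfies |C| · ([k choose 1]_q + 1) ≤ (α−1) · [n choose 1]_q. -/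
open Module

/-- The nonzero vectors lying in some member of `C`. -/
def coveredVectors {F : Type} [Field F] {n : ℕ} (C : Finset (Submodule F (Fin n → F))) :
    Set (Fin n → F) :=
  {v | v ≠ 0 ∧ ∃ U ∈ C, v ∈ U}

section

variable {F : Type} [Field F] {n k δ α : ℕ}

lemma finrank_sup_succ_le_of_inf_ne_bot {U W : Submodule F (Fin n → F)} (h : U ⊓ W ≠ ⊥) :
    finrank F ↥(U ⊔ W) + 1 ≤ finrank F ↥U + finrank F ↥W := by
  have h1 := Submodule.finrank_sup_add_finrank_inf_eq U W
  have h2 : finrank F ↥(U ⊓ W) ≠ 0 := fun h0 => h (Submodule.finrank_eq_zero.mp h0)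
  omega

lemma IsCoveringCode.mono {C D : Finset (Submodule F (Fin n → F))}
    (hC : IsCoveringCode F n k δ α C) (hD : D ⊆ C) : IsCoveringCode F n k δ α D :=
  ⟨fun U hU => hC.1 U (hD hU), fun S hS => hC.2 S (hS.trans hD)⟩

/-- A nonempty code contains a nonempty cluster of fewer than `α` members whose span meets
every other member trivially. -/
lemma IsCoveringCode.exists_isolated_subset {C : Finset (Submodule F (Fin n → F))}
    (hC : IsCoveringCode F n k δ α C) (hα : 2 ≤ α) (hδ : α * k + 2 ≤ k + δ + α)
    (hne : C.Nonempty) :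
    ∃ S ⊆ C, S.Nonempty ∧ S.card + 1 ≤ α ∧ ∀ V ∈ C, V ∉ S → V ⊓ S.sup id = ⊥ := by
  classical
  obtain ⟨U, hU⟩ := hne
  let P : Finset (Finset (Submodule F (Fin n → F))) := C.powerset.filter fun S =>
    S.Nonempty ∧ S.card ≤ α ∧ finrank F ↥(S.sup id) + S.card ≤ S.card * k + 1
  have hUdim : finrank F ↥(({U} : Finset (Submodule F (Fin n → F))).sup id) = k := by
    rw [Finset.sup_singleton]
    exact hC.1 U hU
  have hP : P.Nonempty := ⟨{U}, by simp [P, hU, hUdim]; omega⟩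
  obtain ⟨S, hSP, hmax⟩ := P.exists_max_image Finset.card hP
  simp only [P, Finset.mem_filter, Finset.mem_powerset] at hSP hmax
  obtain ⟨hSC, hSne, hSα, hSdim⟩ := hSP
  have hlt : S.card + 1 ≤ α := by
    rcases hSα.lt_or_eq with h | h
    · exact h
    · have h1 := hC.2 S hSC h
      rw [h] at hSdim
      omega
  refine ⟨S, hSC, hSne, hlt, fun V hV hVS => ?_⟩
  by_contra hint
  have h1 := finrank_sup_succ_le_of_inf_ne_bot hint
  rw [hC.1 V hV] at h1
  have h2 := hmax (insert V S) ⟨Finset.insert_subset hV hSC, Finset.insert_nonempty _ _, by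
    rw [Finset.card_insert_of_notMem hVS]; exact hlt, by
    rw [Finset.card_insert_of_notMem hVS, Finset.sup_insert, add_mul]
    simp only [id]
    omega⟩
  rw [Finset.card_insert_of_notMem hVS] at h2
  omega

variable [Fintype F]

lemma ncard_nonzero_submodule (U : Submodule F (Fin n → F)) :
    {v : Fin n → F | v ≠ 0 ∧ v ∈ U}.ncard + 1 = Fintype.card F ^ finrank F ↥U := by
  have h1 : {v : Fin n → F | v ≠ 0 ∧ v ∈ U} = (U : Set (Fin n → F)) \ {0} := by
    ext v; simp [and_comm]
  rw [h1, Set.ncard_sdiff_singleton_add_one U.zero_mem (Set.toFinite _), ← Nat.card_coe_set_eq,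
    ← Nat.card_eq_fintype_card]
  exact Module.natCard_eq_pow_finrank (K := F) (V := U)

lemma ncard_coveredVectors_le (C : Finset (Submodule F (Fin n → F))) :
    (coveredVectors C).ncard + 1 ≤ Fintype.card F ^ n := by
  have h := ncard_nonzero_submodule (⊤ : Submodule F (Fin n → F))
  rw [finrank_top, Module.finrank_fin_fun] at h
  rw [← h]
  refine Nat.add_le_add_right ?_ 1
  exact Set.ncard_le_ncard (fun v hv => ⟨hv.1, trivial⟩) (Set.toFinite _)

lemma le_ncard_coveredVectors {S : Finset (Submodule F (Fin n → F))}
    (hS : ∀ U ∈ S, finrank F ↥U = k) (hne : S.Nonempty) :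
    Fintype.card F ^ k ≤ (coveredVectors S).ncard + 1 := by
  obtain ⟨U, hU⟩ := hne
  rw [← hS U hU, ← ncard_nonzero_submodule U]
  refine Nat.add_le_add_right ?_ 1
  exact Set.ncard_le_ncard (fun v hv => ⟨hv.1, U, hU, hv.2⟩) (Set.toFinite _)

lemma le_ncard_coveredVectors_of_one_lt_card {S : Finset (Submodule F (Fin n → F))}
    (hS : ∀ U ∈ S, finrank F ↥U = k) (hcard : 1 < S.card) :
    Fintype.card F ^ k + Fintype.card F ≤ (coveredVectors S).ncard + 2 := by
  obtain ⟨U, hU, V, hV, hUV⟩ := Finset.one_lt_card.mp hcard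
  have hle : ¬ V ≤ U := fun h =>
    hUV (Submodule.eq_of_le_of_finrank_eq h (by rw [hS U hU, hS V hV])).symm
  obtain ⟨v, hvV, hvU⟩ := SetLike.not_le_iff_exists.mp hle
  have hv0 : v ≠ 0 := fun h => hvU (h ▸ U.zero_mem)
  have hline := ncard_nonzero_submodule (F ∙ v)
  rw [finrank_span_singleton hv0, pow_one] at hline
  have hplane := ncard_nonzero_submodule U
  rw [hS U hU] at hplane
  have hdisj : Disjoint {w : Fin n → F | w ≠ 0 ∧ w ∈ U} {w | w ≠ 0 ∧ w ∈ F ∙ v} := by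
    rw [Set.disjoint_left]
    rintro w ⟨hw0, hwU⟩ ⟨-, hw⟩
    obtain ⟨c, rfl⟩ := Submodule.mem_span_singleton.mp hw
    have hc : c ≠ 0 := fun h => hw0 (by simp [h])
    exact hvU ((U.smul_mem_iff hc).mp hwU)
  have hsub : {w : Fin n → F | w ≠ 0 ∧ w ∈ U} ∪ {w | w ≠ 0 ∧ w ∈ F ∙ v} ⊆ coveredVectors S := by
    rintro w (⟨hw0, hw⟩ | ⟨hw0, hw⟩)
    · exact ⟨hw0, U, hU, hw⟩
    · exact ⟨hw0, V, hV, (Submodule.span_singleton_le_iff_mem v V).mpr hvV hw⟩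
  have h := Set.ncard_le_ncard hsub (Set.toFinite _)
  rw [Set.ncard_union_eq hdisj (Set.toFinite _) (Set.toFinite _)] at h
  omega

lemma card_mul_le_mul_ncard_coveredVectors_of_card_lt {S : Finset (Submodule F (Fin n → F))}
    (hS : ∀ U ∈ S, finrank F ↥U = k) (hk : 1 ≤ k) (hα : 3 ≤ α) (hne : S.Nonempty)
    (hlt : S.card + 1 ≤ α) :
    S.card * (Fintype.card F ^ k + Fintype.card F - 2) ≤ (α - 1) * (coveredVectors S).ncard := by
  rcases hne.card_pos.nat_succ_le.lt_or_eq with h | h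
  · have := le_ncard_coveredVectors_of_one_lt_card hS h
    exact Nat.mul_le_mul (by omega) (by omega)
  · have h1 := le_ncard_coveredVectors hS hne
    have h2 : Fintype.card F ≤ Fintype.card F ^ k := Nat.le_self_pow (by omega) _
    calc S.card * (Fintype.card F ^ k + Fintype.card F - 2)
        ≤ 2 * (coveredVectors S).ncard := by rw [← h]; omega
      _ ≤ _ := Nat.mul_le_mul_right _ (by omega)

lemma IsCoveringCode.card_mul_le_s6 {C : Finset (Submodule F (Fin n → F))}
    (hC : IsCoveringCode F n k δ α C) (hk : 1 ≤ k) (hα : 3 ≤ α)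
    (hδ : α * k + 2 ≤ k + δ + α) :
    C.card * (Fintype.card F ^ k + Fintype.card F - 2) ≤ (α - 1) * (coveredVectors C).ncard := by
  classical
  induction C using Finset.strongInduction with
  | H C ih =>
    rcases C.eq_empty_or_nonempty with rfl | hne
    · simp
    obtain ⟨S, hSC, hSne, hlt, hiso⟩ := hC.exists_isolated_subset (by omega) hδ hne
    have h1 := ih (C \ S) (Finset.sdiff_ssubset hSC hSne) (hC.mono Finset.sdiff_subset)
    have h2 := card_mul_le_mul_ncard_coveredVectors_of_card_lt (hC.mono hSC).1 hk hα hSne hlt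
    have hdisj : Disjoint (coveredVectors (C \ S)) (coveredVectors S) := by
      rw [Set.disjoint_left]
      rintro v ⟨hv0, V, hV, hvV⟩ ⟨-, U, hU, hvU⟩
      rw [Finset.mem_sdiff] at hV
      have hv : v ∈ V ⊓ S.sup id := ⟨hvV, Finset.le_sup (f := id) hU hvU⟩
      rw [hiso V hV.1 hV.2] at hv
      exact hv0 ((Submodule.mem_bot F).mp hv)
    have hsub : coveredVectors (C \ S) ∪ coveredVectors S ⊆ coveredVectors C := by
      rintro v (⟨hv0, V, hV, hv⟩ | ⟨hv0, V, hV, hv⟩)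
      · exact ⟨hv0, V, Finset.sdiff_subset hV, hv⟩
      · exact ⟨hv0, V, hSC hV, hv⟩
    have h := Set.ncard_le_ncard hsub (Set.toFinite _)
    rw [Set.ncard_union_eq hdisj (Set.toFinite _) (Set.toFinite _)] at h
    calc _ = (C \ S).card * (Fintype.card F ^ k + Fintype.card F - 2)
          + S.card * (Fintype.card F ^ k + Fintype.card F - 2) := by
            rw [← add_mul, Finset.card_sdiff_add_card_eq_card hSC]
      _ ≤ (α - 1) * ((coveredVectors (C \ S)).ncard + (coveredVectors S).ncard) := by
            rw [mul_add]; exact add_le_add h1 h2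
      _ ≤ _ := Nat.mul_le_mul_left _ h

end

/-- If `3 ≤ α ≤ [k,1]_q` and `δ ≥ (α−1)(k−1) + 1`, then every
`α`-`(n,k,δ)_q^c` code `C` satisfies `|C|·([k,1]_q + 1) ≤ (α−1)·[n,1]_q`, i.e.
`B_q(n,k,δ;α) ≤ (α−1)·[n,1]_q/([k,1]_q + 1)`. -/
theorem stmt_6 (q n k δ α : ℕ) (F : Type) [Field F] [Fintype F]
    (hq : Fintype.card F = q) (hq' : IsPrimePow q)
    (hk : 1 ≤ k) (hkn : k < n) (hδ : 1 ≤ δ)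
    (hα : 3 ≤ α) (hα' : (α : ℚ) ≤ gaussBinom q k 1)
    (hδk : (α - 1) * (k - 1) + 1 ≤ δ)
    (C : Finset (Submodule F (Fin n → F))) (hC : IsCoveringCode F n k δ α C) :
    (C.card : ℚ) * (gaussBinom q k 1 + 1) ≤ ((α : ℚ) - 1) * gaussBinom q n 1 := by
  have hq2 : 2 ≤ q := hq'.two_le
  have hδ' : α * k + 2 ≤ k + δ + α := by
    obtain ⟨a, rfl⟩ : ∃ a, α = a + 1 := ⟨α - 1, by omega⟩
    obtain ⟨b, rfl⟩ : ∃ b, k = b + 1 := ⟨k - 1, by omega⟩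
    simp only [Nat.add_sub_cancel] at hδk
    nlinarith
  have h := (hC.card_mul_le_s6 hk hα hδ').trans
    (Nat.mul_le_mul_left (α - 1) (Nat.le_sub_one_of_lt (ncard_coveredVectors_le C)))
  rw [hq] at h
  have hqn : 1 ≤ q ^ n := Nat.one_le_pow _ _ (by omega)
  have hQ : (C.card : ℚ) * ((q : ℚ) ^ k + q - 2) ≤ (α - 1) * ((q : ℚ) ^ n - 1) := by
    have h' := (Nat.cast_le (α := ℚ)).mpr h
    push_cast [Nat.cast_sub (show 2 ≤ q ^ k + q by omega), Nat.cast_sub (show 1 ≤ α by omega),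
      Nat.cast_sub hqn] at h'
    exact h'
  have hpos : (0 : ℚ) < (q : ℚ) - 1 := by
    have : (2 : ℚ) ≤ q := by exact_mod_cast hq2
    linarith
  simp only [gaussBinom, Finset.prod_range_one, pow_zero, pow_one]
  rw [← mul_div_assoc, le_div_iff₀ hpos]
  calc _ = (C.card : ℚ) * ((q : ℚ) ^ k + q - 2) := by field_simp; ring
    _ ≤ _ := hQ
end

section
/- Let q be a prime power. Then B_q(n,2,2;3) = o(q^{2n}) as n → ∞; that is, for every ε > 0 there exists N such that for all n ≥ N, every 3-(n,2,2)_q^c covering Grassmannian code C satisfies |C| ≤ ε · q^{2n}. -/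
open Module

/-- A two-dimensional space is spanned by two vectors. -/
lemma exists_span_pair_eq_of_finrank_eq_two {K V : Type*} [Field K] [AddCommGroup V] [Module K V]
    (U : Submodule K V) (hU : finrank K U = 2) : ∃ p : V × V, Submodule.span K {p.1, p.2} = U := by
  have : FiniteDimensional K U := .of_finrank_pos (by omega)
  let b := finBasisOfFinrankEq K U hU
  refine ⟨(b 0, b 1), ?_⟩
  have h := congrArg (Submodule.map U.subtype) b.span_eq
  rw [Submodule.map_span, Submodule.map_top, Submodule.range_subtype, ← Set.range_comp] at h
  refine Eq.trans ?_ h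
  congr 1
  ext v
  simp [Fin.exists_fin_two, eq_comm]

/-- Choosing a spanning pair of vectors for each codeword of a `3`-`(n,2,2)` covering code gives
a corner-free set. -/
lemma IsCoveringCode.isCornerFree_image {F : Type} [Field F] {n : ℕ}
    {C : Finset (Submodule F (Fin n → F))} (hC : IsCoveringCode F n 2 2 3 C)
    {f : Submodule F (Fin n → F) → (Fin n → F) × (Fin n → F)}
    (hf : ∀ U ∈ C, Submodule.span F {(f U).1, (f U).2} = U) :
    IsCornerFree (f '' C) := by
  classical
  rintro x₁ y₁ x₂ y₂ ⟨⟨U, hU, hUf⟩, ⟨V, hV, hVf⟩, ⟨W, hW, hWf⟩, hxy⟩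
  by_contra hne
  have hy : y₂ = x₂ + y₁ - x₁ := by rw [← hxy]; abel
  have hne' : y₁ ≠ y₂ := by
    rintro rfl
    exact hne (add_right_cancel hxy)
  have hUV : U ≠ V := by rintro rfl; simp_all
  have hUW : U ≠ W := by rintro rfl; simp_all
  have hVW : V ≠ W := by rintro rfl; simp_all
  have hdim := hC.2 {U, V, W} (by simp [Finset.insert_subset_iff, Finset.mem_coe.1 hU,
    Finset.mem_coe.1 hV, Finset.mem_coe.1 hW]) (Finset.card_eq_three.2 ⟨U, V, W, hUV, hUW, hVW, rfl⟩)
  have hle : ({U, V, W} : Finset (Submodule F (Fin n → F))).sup id ≤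
      Submodule.span F (({x₁, y₁, x₂} : Finset (Fin n → F)) : Set (Fin n → F)) := by
    have hx₁ : x₁ ∈ Submodule.span F (({x₁, y₁, x₂} : Finset (Fin n → F)) : Set (Fin n → F)) :=
      Submodule.subset_span (by simp)
    have hy₁ : y₁ ∈ Submodule.span F (({x₁, y₁, x₂} : Finset (Fin n → F)) : Set (Fin n → F)) :=
      Submodule.subset_span (by simp)
    have hx₂ : x₂ ∈ Submodule.span F (({x₁, y₁, x₂} : Finset (Fin n → F)) : Set (Fin n → F)) :=
      Submodule.subset_span (by simp)
    have hy₂ := hy ▸ sub_mem (add_mem hx₂ hy₁) hx₁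
    have hU' := hf U hU
    have hV' := hf V hV
    have hW' := hf W hW
    rw [hUf] at hU'
    rw [hVf] at hV'
    rw [hWf] at hW'
    refine Finset.sup_le fun X hX ↦ ?_
    simp only [Finset.mem_insert, Finset.mem_singleton] at hX
    obtain rfl | rfl | rfl := hX
    · rw [← hU', id, Submodule.span_le, Set.pair_subset_iff]
      exact ⟨hx₁, hy₁⟩
    · rw [← hV', id, Submodule.span_le, Set.pair_subset_iff]
      exact ⟨hx₁, hy₂⟩
    · rw [← hW', id, Submodule.span_le, Set.pair_subset_iff]
      exact ⟨hx₂, hy₁⟩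
  have h₃ : ({x₁, y₁, x₂} : Finset (Fin n → F)).card ≤ 3 := Finset.card_le_three
  have := (Submodule.finrank_mono hle).trans (finrank_span_finset_le_card _)
  omega

/-- `B_q(n,2,2;3) = o(q^{2n})`: for every `ε > 0` there is `N`
such that for all `n ≥ N`, every `3`-`(n,2,2)_q^c` code `C` satisfies
`|C| ≤ ε · q^{2n}`. -/
theorem stmt_7 (q : ℕ) (F : Type) [Field F] [Fintype F]
    (hq : Fintype.card F = q) (hq' : IsPrimePow q) :
    ∀ ε : ℝ, 0 < ε → ∃ N : ℕ, ∀ n : ℕ, N ≤ n →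
      ∀ C : Finset (Submodule F (Fin n → F)), IsCoveringCode F n 2 2 3 C →
        (C.card : ℝ) ≤ ε * (q : ℝ) ^ (2 * n) := by
  classical
  intro ε hε
  refine ⟨cornersTheoremBound ε, fun n hn C hC ↦ ?_⟩
  have hcard : Fintype.card (Fin n → F) = q ^ n := by simp [hq]
  choose! f hf using fun U hU ↦ exists_span_pair_eq_of_finrank_eq_two U (hC.1 U hU)
  have hinj : Set.InjOn f C := fun U hU V hV h ↦ by rw [← hf U hU, ← hf V hV, h]
  by_contra! hlt
  refine corners_theorem ε hε (G := Fin n → F) ?_ (C.image f) ?_ ?_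
  · rw [hcard]
    exact hn.trans (Nat.lt_pow_self hq'.one_lt).le
  · rw [Finset.card_image_of_injOn hinj, hcard]
    push_cast
    rw [← pow_mul, mul_comm n]
    exact hlt.le
  · rw [Finset.coe_image]
    exact hC.isCornerFree_image hf
end

section
/- Let n and k be positive integers with k ≥ 2 and n ≥ 2k + 1. Then B_2(n,k,k+1;3) ≥ 2^{n−2k+1}; that is, there exists a 3-(n,k,k+1)_2^c covering Grassmannian code of cardinality 2^{n−2k+1}. -/
open Module

open Polynomial in
/-- Multiplying a polynomial with at most `k` coefficients by one with at most `l` coefficients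
gives a polynomial with at most `k + l - 1` coefficients. -/
theorem mul_mem_degreeLT {R : Type*} [CommRing R] [IsDomain R] {k l m : ℕ} (h : k + l ≤ m + 1)
    {a p : R[X]} (ha : a ∈ degreeLT R k) (hp : p ∈ degreeLT R l) : p * a ∈ degreeLT R m := by
  by_cases hz : p * a = 0
  · rw [hz]; exact zero_mem _
  have hp0 : p ≠ 0 := left_ne_zero_of_mul hz
  have ha0 : a ≠ 0 := right_ne_zero_of_mul hz
  rw [mem_degreeLT, ← natDegree_lt_iff_degree_lt ‹_›] at *
  rw [natDegree_mul hp0 ha0]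
  omega

open Polynomial in
/-- The map `a ↦ (a, p * a)` whose range is the lifted codeword of the polynomial `p`. -/
noncomputable def liftMap {F : Type*} [Field F] {k l m : ℕ} (h : k + l ≤ m + 1)
    (p : degreeLT F l) : degreeLT F k →ₗ[F] degreeLT F k × degreeLT F m :=
  LinearMap.id.prod
    ((LinearMap.mulLeft F (p : F[X])).restrict fun _ ha => mul_mem_degreeLT h ha p.2)

section LiftMap

open Polynomial

variable {F : Type*} [Field F] {k l m : ℕ} (h : k + l ≤ m + 1)

theorem liftMap_fst (p : degreeLT F l) (a : degreeLT F k) : (liftMap h p a).1 = a := rfl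

theorem liftMap_snd (p : degreeLT F l) (a : degreeLT F k) :
    ((liftMap h p a).2 : F[X]) = p * a := rfl

theorem liftMap_injective (p : degreeLT F l) : Function.Injective (liftMap h p) :=
  fun _ _ hab => congrArg Prod.fst hab

theorem finrank_degreeLT (n : ℕ) : finrank F (degreeLT F n) = n := by
  rw [(degreeLTEquiv F n).finrank_eq, finrank_fin_fun]

instance finite_degreeLT (n : ℕ) : Module.Finite F (degreeLT F n) :=
  Module.Finite.equiv (degreeLTEquiv F n).symm

theorem finrank_range_liftMap (p : degreeLT F l) : finrank F (liftMap h p).range = k := by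
  rw [LinearMap.finrank_range_of_inj (liftMap_injective h p), finrank_degreeLT]

theorem one_mem_degreeLT (hk : 0 < k) : (1 : F[X]) ∈ degreeLT F k := by
  rw [mem_degreeLT, degree_one]
  exact_mod_cast hk

theorem range_liftMap_injective (hk : 0 < k) :
    Function.Injective fun p : degreeLT F l => (liftMap h p).range := by
  intro p q hpq
  obtain ⟨b, hb⟩ : liftMap h p ⟨1, one_mem_degreeLT hk⟩ ∈ (liftMap h q).range :=
    hpq.le (LinearMap.mem_range_self _ _)
  have h1 : b = ⟨1, one_mem_degreeLT hk⟩ := congrArg Prod.fst hb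
  subst h1
  have h2 := congrArg (fun x => (x.2 : F[X])) hb
  simp only [liftMap_snd, mul_one] at h2
  exact Subtype.ext h2.symm

theorem coprod_liftMap_injective {p q : degreeLT F l} (hpq : p ≠ q) :
    Function.Injective ((liftMap h p).coprod (liftMap h q)) := by
  rw [← LinearMap.ker_eq_bot, LinearMap.ker_eq_bot']
  rintro ⟨a, b⟩ hab
  rw [LinearMap.coprod_apply] at hab
  have h1 : a + b = 0 := congrArg Prod.fst hab
  have h2 : (p * a + q * b : F[X]) = 0 := congrArg (fun x => (x.2 : F[X])) hab
  obtain rfl : b = -a := (neg_eq_of_add_eq_zero_right h1).symm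
  have h3 : ((p : F[X]) - q) * a = 0 := by
    rw [← h2]; push_cast; ring
  have h4 : a = 0 := by
    simpa [sub_eq_zero, Subtype.coe_inj, hpq] using h3
  simp [h4]

theorem finrank_range_liftMap_sup {p q : degreeLT F l} (hpq : p ≠ q) :
    finrank F ↥((liftMap h p).range ⊔ (liftMap h q).range) = 2 * k := by
  rw [← LinearMap.range_coprod, LinearMap.finrank_range_of_inj (coprod_liftMap_injective h hpq),
    finrank_prod, finrank_degreeLT, two_mul]

/-- If the codeword of `r` lies in the span of the codewords of `p ≠ q`, then `r` lies on the
affine line through `p` and `q`. -/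
theorem exists_eq_of_range_liftMap_le (hk : 0 < k) {p q r : degreeLT F l} (hpq : p ≠ q)
    (hr : (liftMap h r).range ≤ (liftMap h p).range ⊔ (liftMap h q).range) :
    ∃ t : F, (r : F[X]) - p = C t * (q - p) := by
  have key (a : degreeLT F k) : ∃ c ∈ degreeLT F k, (r - p : F[X]) * a = c * (q - p) := by
    have ha := hr (LinearMap.mem_range_self _ a)
    rw [← LinearMap.range_coprod] at ha
    obtain ⟨⟨b, c⟩, hbc⟩ := ha
    rw [LinearMap.coprod_apply] at hbc
    have h1 : b + c = a := congrArg Prod.fst hbc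
    have h2 : (p * b + q * c : F[X]) = r * a := congrArg (fun x => (x.2 : F[X])) hbc
    refine ⟨c, c.2, ?_⟩
    rw [sub_mul, ← h2, ← h1]; push_cast; ring
  obtain ⟨c, -, hc⟩ := key ⟨1, one_mem_degreeLT hk⟩
  have hX : (X ^ (k - 1) : F[X]) ∈ degreeLT F k := by
    rw [mem_degreeLT, degree_X_pow]
    exact_mod_cast Nat.sub_lt hk one_pos
  obtain ⟨d, hd, hcd⟩ := key ⟨X ^ (k - 1), hX⟩
  have hqp : (q - p : F[X]) ≠ 0 := by
    simpa [sub_eq_zero, Subtype.coe_inj] using hpq.symm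
  simp only [mul_one] at hc
  have hdc : d = c * X ^ (k - 1) := by
    apply mul_right_cancel₀ hqp
    rw [← hcd, hc]; ring
  refine ⟨c.coeff 0, ?_⟩
  rw [hc, ← eq_C_of_degree_le_zero]
  by_cases hc0 : c = 0
  · simp [hc0]
  rw [← natDegree_eq_zero_iff_degree_le_zero]
  have hd0 : d ≠ 0 := by rw [hdc]; exact mul_ne_zero hc0 (pow_ne_zero _ X_ne_zero)
  rw [mem_degreeLT, ← natDegree_lt_iff_degree_lt hd0, hdc, natDegree_mul_X_pow _ hc0] at hd
  omega

end LiftMap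

open Polynomial in
theorem lt_finrank_range_liftMap_sup {k l m : ℕ} (h : k + l ≤ m + 1) (hk : 0 < k)
    {p q r : degreeLT (ZMod 2) l} (hpq : p ≠ q) (hpr : p ≠ r) (hqr : q ≠ r) :
    2 * k < finrank (ZMod 2)
      ↥((liftMap h p).range ⊔ (liftMap h q).range ⊔ (liftMap h r).range) := by
  rw [← finrank_range_liftMap_sup h hpq]
  refine Submodule.finrank_lt_finrank_of_lt (left_lt_sup.2 fun hr => ?_)
  obtain ⟨t, ht⟩ := exists_eq_of_range_liftMap_le h hk hpq hr
  obtain rfl | rfl : t = 0 ∨ t = 1 := by clear ht; revert t; decide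
  · exact hpr (Subtype.ext (sub_eq_zero.1 (by simpa using ht)).symm)
  · exact hqr (Subtype.ext (by simpa using ht.symm))

/-- For `k ≥ 2` and `n ≥ 2k + 1` there exists a
`3`-`(n,k,k+1)_2^c` covering Grassmannian code of cardinality `2^{n−2k+1}`,
hence `B_2(n,k,k+1;3) ≥ 2^{n−2k+1}`. -/
theorem stmt_9 (n k : ℕ) (hk : 2 ≤ k) (hn : 2 * k + 1 ≤ n) :
    ∃ C : Finset (Submodule (ZMod 2) (Fin n → ZMod 2)),
      IsCoveringCode (ZMod 2) n k (k + 1) 3 C ∧ C.card = 2 ^ (n - 2 * k + 1) := by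
  classical
  have h : k + (n - 2 * k + 1) ≤ (n - k) + 1 := by omega
  let e : (Polynomial.degreeLT (ZMod 2) k × Polynomial.degreeLT (ZMod 2) (n - k)) ≃ₗ[ZMod 2]
      (Fin n → ZMod 2) := LinearEquiv.ofFinrankEq _ _ (by
    rw [finrank_prod, finrank_degreeLT, finrank_degreeLT, finrank_fin_fun]; omega)
  let f (p : Polynomial.degreeLT (ZMod 2) (n - 2 * k + 1)) :=
    (liftMap h p).range.map (e : _ →ₗ[ZMod 2] (Fin n → ZMod 2))
  have hf : Function.Injective f :=
    (Submodule.map_injective_of_injective e.injective).comp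
      (range_liftMap_injective h (by omega))
  have := Module.finite_of_finite (ZMod 2)
    (M := Polynomial.degreeLT (ZMod 2) (n - 2 * k + 1))
  have := Fintype.ofFinite (Polynomial.degreeLT (ZMod 2) (n - 2 * k + 1))
  refine ⟨Finset.univ.image f, ⟨?_, ?_⟩, ?_⟩
  · simp only [Finset.mem_image, Finset.mem_univ, true_and, forall_exists_index,
      forall_apply_eq_imp_iff]
    intro p
    rw [LinearEquiv.finrank_map_eq, finrank_range_liftMap]
  · intro S hS hcard
    obtain ⟨U, V, W, hUV, hUW, hVW, rfl⟩ := Finset.card_eq_three.1 hcard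
    obtain ⟨p, -, rfl⟩ := Finset.mem_image.1 (hS (by simp : U ∈ _))
    obtain ⟨q, -, rfl⟩ := Finset.mem_image.1 (hS (by simp : V ∈ _))
    obtain ⟨r, -, rfl⟩ := Finset.mem_image.1 (hS (by simp : W ∈ _))
    have hlt := lt_finrank_range_liftMap_sup h (by omega) (ne_of_apply_ne f hUV)
      (ne_of_apply_ne f hUW) (ne_of_apply_ne f hVW)
    rw [← LinearEquiv.finrank_map_eq e, Submodule.map_sup, Submodule.map_sup] at hlt
    rw [Finset.sup_insert, Finset.sup_insert, Finset.sup_singleton, id, id, id, ← sup_assoc]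
    change 2 * k < finrank (ZMod 2) ↥(f p ⊔ f q ⊔ f r) at hlt
    omega
  · rw [Finset.card_image_of_injective _ hf, Finset.card_univ,
      Module.card_eq_pow_finrank (K := ZMod 2), finrank_degreeLT, ZMod.card]
end

section
/- Let n, k and γ be positive integers with γ + 1 ≤ k < 3⌈γ/2⌉ and n ≥ 2k + γ. Then B_2(n,k,k+γ;3) ≥ 2^{2⌊(n−2k+1)/(k+1)⌋}; that is, there exists a 3-(n,k,k+γ)_2^c covering Grassmannian code of cardinality 2^{2⌊(n−2k+1)/(k+1)⌋}. -/
open Module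

/-- If a vector space over `F_2` has at most one nonzero vector, its dimension is at most one. -/
theorem finrank_le_one_of_nonzero_eq {E : Type*} [AddCommGroup E] [Module (ZMod 2) E]
    (h : ∀ p q : E, p ≠ 0 → q ≠ 0 → p = q) : finrank (ZMod 2) E ≤ 1 := by
  by_cases hE : ∃ p : E, p ≠ 0
  · obtain ⟨p, hp⟩ := hE
    refine finrank_le_one p fun w => ?_
    by_cases hw : w = 0
    · exact ⟨0, by simp [hw]⟩
    · exact ⟨1, by rw [one_smul, h p w hp hw]⟩
  · push Not at hE
    exact finrank_le_one 0 fun w => ⟨0, by simp [hE w]⟩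

section Graph

variable {V U W : Type*} [AddCommGroup V] [Module (ZMod 2) V]
  [AddCommGroup U] [Module (ZMod 2) U] [AddCommGroup W] [Module (ZMod 2) W]

/-- A bilinear map `φ` is *almost nonsingular on pairs* if for distinct nonzero `a`, `b` the map
`(u, v) ↦ φ a u + φ b v` has at most one nonzero vector in its kernel. -/
def AlmostNonsingularOnPairs (φ : V →ₗ[ZMod 2] U →ₗ[ZMod 2] W) : Prop :=
  ∀ a b : V, a ≠ 0 → b ≠ 0 → a ≠ b → ∀ p q : U × U, p ≠ 0 → q ≠ 0 →
    φ a p.1 + φ b p.2 = 0 → φ a q.1 + φ b q.2 = 0 → p = q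

/-- Three distinct graphs `{(u, φ x u)}` span a space of codimension at most one in the
external sum of the three graphs. -/
theorem finrank_graph_sup_graph_sup_graph [FiniteDimensional (ZMod 2) U]
    {φ : V →ₗ[ZMod 2] U →ₗ[ZMod 2] W} (hφ : AlmostNonsingularOnPairs φ)
    {x y z : V} (hxy : x ≠ y) (hxz : x ≠ z) (hyz : y ≠ z) :
    3 * finrank (ZMod 2) U ≤
      finrank (ZMod 2) ↥((φ x).graph ⊔ ((φ y).graph ⊔ (φ z).graph)) + 1 := by
  let g (t : V) : U →ₗ[ZMod 2] U × W := LinearMap.id.prod (φ t)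
  let f : U × (U × U) →ₗ[ZMod 2] U × W := (g x).coprod ((g y).coprod (g z))
  have hrange : LinearMap.range f = (φ x).graph ⊔ ((φ y).graph ⊔ (φ z).graph) := by
    simp only [f, g, LinearMap.range_coprod, LinearMap.graph_eq_range_prod]
  have hker : finrank (ZMod 2) (LinearMap.ker f) ≤ 1 := by
    have key : ∀ p ∈ LinearMap.ker f, p.1 = -(p.2.1 + p.2.2) ∧
        φ (y - x) p.2.1 + φ (z - x) p.2.2 = 0 := by
      rintro ⟨u, v, w⟩ hp
      simp only [f, g, LinearMap.mem_ker, LinearMap.coprod_apply, LinearMap.prod_apply,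
        Function.prod, LinearMap.id_apply, Prod.mk_add_mk, Prod.mk_eq_zero] at hp
      obtain ⟨h₁, h₂⟩ := hp
      have hu : u = -(v + w) := eq_neg_of_add_eq_zero_left h₁
      refine ⟨hu, ?_⟩
      rw [← h₂, hu]
      simp only [map_sub, map_neg, map_add, LinearMap.sub_apply]
      abel
    refine finrank_le_one_of_nonzero_eq fun p q hp hq => ?_
    obtain ⟨hp₁, hp₂⟩ := key p p.2
    obtain ⟨hq₁, hq₂⟩ := key q q.2
    have hne : ∀ r : LinearMap.ker f, r ≠ 0 → r.1.1 = -(r.1.2.1 + r.1.2.2) → r.1.2 ≠ 0 := by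
      intro r hr hr₁ h0
      apply hr
      ext1
      refine Prod.ext ?_ h0
      rw [hr₁, h0]
      simp
    have h := hφ (y - x) (z - x) (sub_ne_zero.2 hxy.symm) (sub_ne_zero.2 hxz.symm)
      (fun h => hyz (sub_left_injective h)) p.1.2 q.1.2 (hne p hp hp₁) (hne q hq hq₁) hp₂ hq₂
    ext1
    refine Prod.ext ?_ h
    rw [hp₁, hq₁, h]
  have hrn := LinearMap.finrank_range_add_finrank_ker f
  rw [hrange, finrank_prod, finrank_prod] at hrn
  omega

/-- The graphs of an injective family of linear maps that is almost nonsingular on pairs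
form a covering Grassmannian code. -/
theorem exists_isCoveringCode_of_almostNonsingularOnPairs [Fintype V]
    [FiniteDimensional (ZMod 2) U] [FiniteDimensional (ZMod 2) W]
    {φ : V →ₗ[ZMod 2] U →ₗ[ZMod 2] W} (hφ : AlmostNonsingularOnPairs φ)
    (hinj : Function.Injective φ) {n δ : ℕ}
    (hn : finrank (ZMod 2) U + finrank (ZMod 2) W ≤ n)
    (hδ : δ + 1 ≤ 2 * finrank (ZMod 2) U) :
    ∃ C : Finset (Submodule (ZMod 2) (Fin n → ZMod 2)),
      IsCoveringCode (ZMod 2) n (finrank (ZMod 2) U) δ 3 C ∧ C.card = Fintype.card V := by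
  classical
  obtain ⟨ι, hι⟩ : ∃ ι : U × W →ₗ[ZMod 2] (Fin n → ZMod 2), Function.Injective ι := by
    apply finrank_le_iff_exists_linearMap.1
    rwa [finrank_prod, finrank_fin_fun]
  let code (x : V) : Submodule (ZMod 2) (Fin n → ZMod 2) := (φ x).graph.map ι
  have hcode : Function.Injective code := by
    intro x y hxy
    have h := Submodule.map_injective_of_injective hι hxy
    apply hinj
    ext u
    have hu : (u, φ x u) ∈ (φ y).graph := h ▸ (LinearMap.mem_graph_iff (φ x) (u, φ x u)).2 rfl
    simpa [LinearMap.mem_graph_iff] using hu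
  refine ⟨Finset.univ.image code, ⟨?_, ?_⟩, ?_⟩
  · intro X hX
    obtain ⟨x, -, rfl⟩ := Finset.mem_image.1 hX
    rw [← (Submodule.equivMapOfInjective ι hι _).finrank_eq, LinearMap.graph_eq_range_prod]
    exact LinearMap.finrank_range_of_inj fun u v h => congrArg Prod.fst h
  · intro S hS hcard
    obtain ⟨X, Y, Z, hXY, hXZ, hYZ, rfl⟩ := Finset.card_eq_three.1 hcard
    obtain ⟨x, -, rfl⟩ := Finset.mem_image.1 (hS (by simp : X ∈ _))
    obtain ⟨y, -, rfl⟩ := Finset.mem_image.1 (hS (by simp : Y ∈ _))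
    obtain ⟨z, -, rfl⟩ := Finset.mem_image.1 (hS (by simp : Z ∈ _))
    have h := finrank_graph_sup_graph_sup_graph hφ (x := x) (y := y) (z := z)
      (fun h => hXY (h ▸ rfl)) (fun h => hXZ (h ▸ rfl)) (fun h => hYZ (h ▸ rfl))
    have hsup : ({code x, code y, code z} : Finset _).sup id =
        ((φ x).graph ⊔ ((φ y).graph ⊔ (φ z).graph)).map ι := by
      simp [code, Submodule.map_sup]
    rw [hsup, ← (Submodule.equivMapOfInjective ι hι _).finrank_eq]
    omega
  · rw [Finset.card_image_of_injective _ hcode, Finset.card_univ]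

end Graph

/-- The bilinear map `(a, u) ↦ (a u, a u²)` on a field of characteristic two. -/
def mulFrobenius (L : Type*) [Field L] [Algebra (ZMod 2) L] :
    L →ₗ[ZMod 2] L →ₗ[ZMod 2] L × L :=
  LinearMap.mk₂ (ZMod 2) (fun a u => (a * u, a * u ^ 2))
    (fun a b u => by simp [add_mul]) (fun c a u => by simp)
    (fun a u v => by
      have : CharP L 2 := charP_of_injective_algebraMap (algebraMap (ZMod 2) L).injective 2
      simp [mul_add, add_pow_char])
    (fun c a u => by
      have hc : c ^ 2 = c := by revert c; decide
      simp [smul_pow, hc])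

theorem mulFrobenius_apply (L : Type*) [Field L] [Algebra (ZMod 2) L] (a u : L) :
    mulFrobenius L a u = (a * u, a * u ^ 2) := rfl

theorem mulFrobenius_pair_eq_zero {L : Type*} [Field L] [Algebra (ZMod 2) L] {a b u v : L}
    (ha : a ≠ 0) (hb : b ≠ 0) (hab : a ≠ b)
    (h : mulFrobenius L a u + mulFrobenius L b v = 0) : u = 0 ∧ v = 0 := by
  have : CharP L 2 := charP_of_injective_algebraMap (algebraMap (ZMod 2) L).injective 2
  simp only [mulFrobenius_apply, Prod.mk_add_mk, Prod.mk_eq_zero] at h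
  obtain ⟨h₁, h₂⟩ := h
  have hv : b * v * (u - v) = 0 := by linear_combination u * h₁ - h₂
  have huv : b * v = a * u := by
    linear_combination h₁ - CharTwo.two_eq_zero (R := L) * (a * u)
  rcases mul_eq_zero.1 hv with h0 | h0
  · have hv0 : v = 0 := by simpa [hb] using h0
    exact ⟨by simpa [hv0, ha] using huv.symm, hv0⟩
  · have h1 : u = v := sub_eq_zero.1 h0
    have hv0 : v = 0 := by
      by_contra hv0
      exact hab (mul_right_cancel₀ hv0 (by rw [huv, h1]))
    exact ⟨h1.trans hv0, hv0⟩

/-- The code obtained by restricting `mulFrobenius` to subspaces of the field of order `2 ^ M`. -/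
theorem exists_isCoveringCode_of_field {n k δ d M : ℕ} (hk : 1 ≤ k) (hM : M ≠ 0)
    (hkM : k ≤ M) (hdM : d ≤ M) (hn : k + 2 * M ≤ n) (hδ : δ + 1 ≤ 2 * k) :
    ∃ C : Finset (Submodule (ZMod 2) (Fin n → ZMod 2)),
      IsCoveringCode (ZMod 2) n k δ 3 C ∧ C.card = 2 ^ d := by
  have : Fact (Nat.Prime 2) := ⟨Nat.prime_two⟩
  let L := GaloisField 2 M
  have hL : finrank (ZMod 2) L = M := GaloisField.finrank 2 hM
  obtain ⟨i, hi⟩ : ∃ i : (Fin d → ZMod 2) →ₗ[ZMod 2] L, Function.Injective i :=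
    finrank_le_iff_exists_linearMap.1 (by rwa [finrank_fin_fun, hL])
  obtain ⟨j, hj⟩ : ∃ j : (Fin k → ZMod 2) →ₗ[ZMod 2] L, Function.Injective j :=
    finrank_le_iff_exists_linearMap.1 (by rwa [finrank_fin_fun, hL])
  let φ := (mulFrobenius L).compl₁₂ i j
  have hφ : AlmostNonsingularOnPairs φ := by
    intro a b ha hb hab p q hp _ hp0 _
    obtain ⟨h₁, h₂⟩ := mulFrobenius_pair_eq_zero ((map_ne_zero_iff i hi).2 ha)
      ((map_ne_zero_iff i hi).2 hb) (hi.ne hab) hp0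
    exact absurd (Prod.ext ((map_eq_zero_iff j hj).1 h₁) ((map_eq_zero_iff j hj).1 h₂)) hp
  have hinj : Function.Injective φ := by
    intro a b hab
    have hu : j (fun _ => 1) ≠ 0 := (map_ne_zero_iff j hj).2 fun h =>
      one_ne_zero (congrFun h ⟨0, hk⟩)
    have h : mulFrobenius L (i a) (j fun _ => 1) = mulFrobenius L (i b) (j fun _ => 1) :=
      LinearMap.congr_fun hab _
    exact hi (mul_right_cancel₀ hu (congrArg Prod.fst h))
  have := exists_isCoveringCode_of_almostNonsingularOnPairs hφ hinj (n := n) (δ := δ)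
    (by rw [finrank_prod, hL, finrank_fin_fun]; omega) (by rw [finrank_fin_fun]; exact hδ)
  simpa [finrank_fin_fun, ZMod.card] using this

/-- The bilinear map sending `(x₁, x₂)` and `(u₁, u₂)` to
`(u₁ x₂, u₂ x₁, u₁ x₁ + u₂ x₂)`. -/
def pairMul (E : Type*) [AddCommGroup E] [Module (ZMod 2) E] :
    (E × E) →ₗ[ZMod 2] (ZMod 2 × ZMod 2) →ₗ[ZMod 2] E × E × E :=
  LinearMap.mk₂ (ZMod 2) (fun x u => (u.1 • x.2, u.2 • x.1, u.1 • x.1 + u.2 • x.2))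
    (fun x y u => by ext <;> simp; abel)
    (fun c x u => by ext <;> simp [smul_comm c])
    (fun x u v => by ext <;> simp [add_smul]; abel)
    (fun c x u => by ext <;> simp [mul_smul])

theorem pairMul_apply (E : Type*) [AddCommGroup E] [Module (ZMod 2) E] (x : E × E)
    (u : ZMod 2 × ZMod 2) :
    pairMul E x u = (u.1 • x.2, u.2 • x.1, u.1 • x.1 + u.2 • x.2) := rfl

/-- The possible nonzero vectors in the kernel of `(u, v) ↦ pairMul E a u + pairMul E b v`. -/
theorem pairMul_pair_eq_zero {E : Type*} [AddCommGroup E] [Module (ZMod 2) E] {a b : E × E}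
    (ha : a ≠ 0) (hb : b ≠ 0) (hab : a ≠ b) {p : (ZMod 2 × ZMod 2) × (ZMod 2 × ZMod 2)}
    (hp : p ≠ 0) (h : pairMul E a p.1 + pairMul E b p.2 = 0) :
    (p = ((1, 0), (0, 1)) ∧ a.2 = 0 ∧ b.1 = 0 ∧ a.1 = b.2) ∨
    (p = ((0, 1), (1, 0)) ∧ b.2 = 0 ∧ a.1 = 0 ∧ a.2 = b.1) ∨
    (p = ((1, 1), (0, 1)) ∧ a.2 = 0 ∧ b.1 = a.1 ∧ b.2 = a.1) ∨
    (p = ((1, 1), (1, 0)) ∧ a.1 = 0 ∧ b.1 = a.2 ∧ b.2 = a.2) ∨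
    (p = ((0, 1), (1, 1)) ∧ b.2 = 0 ∧ a.1 = b.1 ∧ a.2 = b.1) ∨
    (p = ((1, 0), (1, 1)) ∧ b.1 = 0 ∧ a.1 = b.2 ∧ a.2 = b.2) := by
  obtain ⟨a₁, a₂⟩ := a
  obtain ⟨b₁, b₂⟩ := b
  obtain ⟨⟨p₁, p₂⟩, p₃, p₄⟩ := p
  have hchar : ∀ x y : E, x + y = 0 ↔ x = y := fun x y => by
    rw [add_eq_zero_iff_eq_neg, ZModModule.neg_eq_self]
  have h01 : ∀ c : ZMod 2, c = 0 ∨ c = 1 := by decide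
  simp only [pairMul_apply, Prod.mk_add_mk, Prod.mk_eq_zero] at h
  obtain ⟨h₁, h₂, h₃⟩ := h
  rcases h01 p₁ with rfl | rfl <;> rcases h01 p₂ with rfl | rfl <;>
  rcases h01 p₃ with rfl | rfl <;> rcases h01 p₄ with rfl | rfl <;>
  simp only [zero_smul, one_smul, zero_add, add_zero, hchar] at h₁ h₂ h₃ <;>
  subst_vars <;> simp_all

theorem almostNonsingularOnPairs_pairMul (E : Type*) [AddCommGroup E] [Module (ZMod 2) E] :
    AlmostNonsingularOnPairs (pairMul E) := by
  rintro ⟨a₁, a₂⟩ ⟨b₁, b₂⟩ ha hb hab p q hp hq hp0 hq0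
  rcases pairMul_pair_eq_zero ha hb hab hp hp0 with h | h | h | h | h | h <;>
  rcases pairMul_pair_eq_zero ha hb hab hq hq0 with h' | h' | h' | h' | h' | h' <;>
  obtain ⟨rfl, h₁, h₂, h₃⟩ := h <;> obtain ⟨rfl, h₁', h₂', h₃'⟩ := h' <;>
  first
  | rfl
  | simp_all

/-- The code of `2`-dimensional subspaces obtained from `pairMul`. -/
theorem exists_isCoveringCode_two {n m : ℕ} (hn : 3 * m + 2 ≤ n) :
    ∃ C : Finset (Submodule (ZMod 2) (Fin n → ZMod 2)),
      IsCoveringCode (ZMod 2) n 2 3 3 C ∧ C.card = 2 ^ (2 * m) := by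
  have hinj : Function.Injective (pairMul (Fin m → ZMod 2)) := by
    intro x y hxy
    have h : ((1 : ZMod 2) • x.2, (0 : ZMod 2) • x.1, (1 : ZMod 2) • x.1 + (0 : ZMod 2) • x.2) =
        ((1 : ZMod 2) • y.2, (0 : ZMod 2) • y.1, (1 : ZMod 2) • y.1 + (0 : ZMod 2) • y.2) :=
      LinearMap.congr_fun hxy (1, 0)
    simp only [one_smul, zero_smul, add_zero, Prod.mk.injEq] at h
    exact Prod.ext h.2.2 h.1
  have := exists_isCoveringCode_of_almostNonsingularOnPairs
    (almostNonsingularOnPairs_pairMul (Fin m → ZMod 2)) hinj (n := n) (δ := 3)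
    (by simp only [finrank_prod, finrank_fin_fun, finrank_self]; omega)
    (by simp [finrank_prod])
  simpa [finrank_prod, ZMod.card, ← pow_add, two_mul] using this

/-- For `γ + 1 ≤ k < 3⌈γ/2⌉` and `n ≥ 2k + γ` there exists a
`3`-`(n,k,k+γ)_2^c` code of cardinality `2^{2⌊(n−2k+1)/(k+1)⌋}`. -/
theorem stmt_12 (n k γ : ℕ) (hγ : 1 ≤ γ) (hk : γ + 1 ≤ k)
    (hk' : k < 3 * ((γ + 1) / 2)) (hn : 2 * k + γ ≤ n) :
    ∃ C : Finset (Submodule (ZMod 2) (Fin n → ZMod 2)),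
      IsCoveringCode (ZMod 2) n k (k + γ) 3 C ∧
      C.card = 2 ^ (2 * ((n - 2 * k + 1) / (k + 1))) := by
  obtain ⟨m, hm⟩ : ∃ m, (n - 2 * k + 1) / (k + 1) = m := ⟨_, rfl⟩
  have hmn : m * (k + 1) ≤ n - 2 * k + 1 := hm ▸ Nat.div_mul_le_self _ _
  rw [hm]
  obtain hk2 | hk3 : k = 2 ∨ 3 ≤ k := by omega
  · obtain rfl : γ = 1 := by omega
    subst hk2
    exact exists_isCoveringCode_two (by omega)
  obtain rfl | hm0 := Nat.eq_zero_or_pos m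
  · obtain ⟨X, hX⟩ : ∃ X : Submodule (ZMod 2) (Fin n → ZMod 2), finrank (ZMod 2) X = k := by
      obtain ⟨i, hi⟩ : ∃ i : (Fin k → ZMod 2) →ₗ[ZMod 2] (Fin n → ZMod 2), Function.Injective i :=
        finrank_le_iff_exists_linearMap.1 (by simp only [finrank_fin_fun]; omega)
      exact ⟨LinearMap.range i, by rw [LinearMap.finrank_range_of_inj hi, finrank_fin_fun]⟩
    refine ⟨{X}, ⟨by simpa using hX, fun S hS hcard => ?_⟩, by simp⟩
    have := Finset.card_le_card hS
    simp only [Finset.card_singleton] at this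
    omega
  · refine exists_isCoveringCode_of_field (M := max k (2 * m)) (by omega) (by omega)
      (le_max_left _ _) (le_max_right _ _) ?_ (by omega)
    have h₁ : k ≤ m * k := Nat.le_mul_of_pos_left k hm0
    have h₂ : m * 3 ≤ m * k := Nat.mul_le_mul_left m hk3
    rw [mul_add, mul_one] at hmn
    rcases max_cases k (2 * m) with ⟨h, -⟩ | ⟨h, -⟩ <;> rw [h] <;> omega
end

section
/- Let n and k be positive integers with n ≥ 3k. Then B_2(n,k,2k;3) ≥ 2^{⌊(n−k)/k⌋}; that is, there exists a 3-(n,k,2k)_2^c covering Grassmannian code of cardinality 2^{⌊(n−k)/k⌋}. -/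
/-- The coefficient at position `j` of the lifted block matrix `(I | a₀ I | ⋯ | a_{t-1} I | 0)`,
whose blocks have `k` columns. -/
def blockCoeff (k t : ℕ) (a : Fin t → ZMod 2) (j : ℕ) : ZMod 2 :=
  if j < k then 1 else if h : j / k - 1 < t then a ⟨j / k - 1, h⟩ else 0

/-- The linear map `x ↦ (x, a₀ x, …, a_{t-1} x, 0)` given by the lifted block matrix. -/
def blockMap (n k t : ℕ) (hk : 1 ≤ k) (a : Fin t → ZMod 2) :
    (Fin k → ZMod 2) →ₗ[ZMod 2] (Fin n → ZMod 2) where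
  toFun x j := blockCoeff k t a j * x ⟨j % k, Nat.mod_lt _ hk⟩
  map_add' x y := by ext j; simp [mul_add]
  map_smul' c x := by ext j; simp [mul_left_comm]

section
variable {n k t : ℕ} (hk : 1 ≤ k)

lemma blockMap_apply_head (a : Fin t → ZMod 2) (x : Fin k → ZMod 2) (r : Fin k)
    (h : r.1 < n) : blockMap n k t hk a x ⟨r, h⟩ = x r := by
  simp [blockMap, blockCoeff, Nat.mod_eq_of_lt r.2]

lemma blockMap_apply_tail (a : Fin t → ZMod 2) (x : Fin k → ZMod 2) (r : Fin k) (i : Fin t)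
    (h : r.1 + k * (i + 1) < n) :
    blockMap n k t hk a x ⟨r + k * (i + 1), h⟩ = a i * x r := by
  have h1 : ¬ (r.1 + k * (i + 1) < k) := by nlinarith [Nat.zero_le (k * i.1)]
  have h2 : (r.1 + k * (i + 1)) / k = i + 1 := by
    rw [Nat.add_mul_div_left _ _ hk, Nat.div_eq_of_lt r.2, zero_add]
  simp [blockMap, blockCoeff, h1, h2, Nat.mod_eq_of_lt r.2]

lemma tail_index_lt (hn : k * (t + 1) ≤ n) (r : Fin k) (i : Fin t) :
    r.1 + k * (i + 1) < n := by
  have := Nat.mul_le_mul_left k (show i.1 + 2 ≤ t + 1 by omega)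
  have := r.2
  nlinarith

lemma head_index_lt (hn : k * (t + 1) ≤ n) (r : Fin k) : r.1 < n := by
  have := r.2
  nlinarith [Nat.zero_le (k * t)]

lemma blockMap_injective (hn : k * (t + 1) ≤ n) (a : Fin t → ZMod 2) :
    Function.Injective (blockMap n k t hk a) := by
  intro x y h
  ext r
  have := congrFun h ⟨r, head_index_lt hn r⟩
  rwa [blockMap_apply_head, blockMap_apply_head] at this

lemma range_blockMap_injective (hn : k * (t + 1) ≤ n) :
    Function.Injective fun a => LinearMap.range (blockMap n k t hk a) := by
  intro a b h
  ext1 i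
  have hm : blockMap n k t hk a 1 ∈ LinearMap.range (blockMap n k t hk b) := by
    rw [← show _ = LinearMap.range (blockMap n k t hk b) from h]
    exact LinearMap.mem_range_self _ _
  obtain ⟨y, hy⟩ := hm
  let r : Fin k := ⟨0, hk⟩
  have h0 := congrFun hy ⟨r, head_index_lt hn r⟩
  have h1 := congrFun hy ⟨r + k * (i + 1), tail_index_lt hn r i⟩
  rw [blockMap_apply_head, blockMap_apply_head] at h0
  rw [blockMap_apply_tail, blockMap_apply_tail, h0] at h1
  simpa using h1.symm

lemma zmod_two_eq_zero_or_eq_zero : ∀ {a b c x y z : ZMod 2}, a ≠ b → x + y + z = 0 →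
    a * x + b * y + c * z = 0 → x = 0 ∨ y = 0 := by
  decide

lemma zmod_two_eq_zero_of_pairwise : ∀ {x y z : ZMod 2}, x + y + z = 0 → (x = 0 ∨ y = 0) →
    (y = 0 ∨ z = 0) → (z = 0 ∨ x = 0) → x = 0 ∧ y = 0 ∧ z = 0 := by
  decide

lemma coprod_blockMap_injective (hn : k * (t + 1) ≤ n) {a b c : Fin t → ZMod 2}
    (hab : a ≠ b) (hbc : b ≠ c) (hca : c ≠ a) :
    Function.Injective ((blockMap n k t hk a).coprod
      ((blockMap n k t hk b).coprod (blockMap n k t hk c))) := by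
  rw [injective_iff_map_eq_zero]
  rintro ⟨x, y, z⟩ h
  simp only [LinearMap.coprod_apply] at h
  have head (r : Fin k) : x r + y r + z r = 0 := by
    have := congrFun h ⟨r, head_index_lt hn r⟩
    simpa only [Pi.add_apply, blockMap_apply_head, Pi.zero_apply, ← add_assoc] using this
  have tail (r : Fin k) (i : Fin t) : a i * x r + b i * y r + c i * z r = 0 := by
    have := congrFun h ⟨r + k * (i + 1), tail_index_lt hn r i⟩
    simpa only [Pi.add_apply, blockMap_apply_tail, Pi.zero_apply, ← add_assoc] using this
  obtain ⟨i, hi⟩ := Function.ne_iff.mp hab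
  obtain ⟨j, hj⟩ := Function.ne_iff.mp hbc
  obtain ⟨l, hl⟩ := Function.ne_iff.mp hca
  have key (r : Fin k) : x r = 0 ∧ y r = 0 ∧ z r = 0 := by
    have h0 := head r
    refine zmod_two_eq_zero_of_pairwise h0 (zmod_two_eq_zero_or_eq_zero hi h0 (tail r i))
      (zmod_two_eq_zero_or_eq_zero (c := a j) (z := x r) hj ?_ ?_)
      (zmod_two_eq_zero_or_eq_zero (c := b l) (z := y r) hl ?_ ?_)
    · rw [← h0]; ring
    · rw [← tail r j]; ring
    · rw [← h0]; ring
    · rw [← tail r l]; ring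
  simp only [Prod.mk_eq_zero]
  exact ⟨funext fun r => (key r).1, funext fun r => (key r).2.1, funext fun r => (key r).2.2⟩

end


open Module

/-- For `n ≥ 3k` there exists a `3`-`(n,k,2k)_2^c` code of
cardinality `2^{⌊(n−k)/k⌋}`, hence `B_2(n,k,2k;3) ≥ 2^{⌊(n−k)/k⌋}`. -/
theorem stmt_13 (n k : ℕ) (hk : 1 ≤ k) (hn : 3 * k ≤ n) :
    ∃ C : Finset (Submodule (ZMod 2) (Fin n → ZMod 2)),
      IsCoveringCode (ZMod 2) n k (2 * k) 3 C ∧ C.card = 2 ^ ((n - k) / k) := by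

  classical
  have hn' : k * ((n - k) / k + 1) ≤ n := by
    have := Nat.mul_div_le (n - k) k
    rw [mul_add, mul_one]
    omega
  refine ⟨Finset.univ.map ⟨_, range_blockMap_injective hk hn'⟩, ⟨?_, ?_⟩, by simp⟩
  · intro U hU
    simp only [Finset.mem_map, Finset.mem_univ, true_and, Function.Embedding.coeFn_mk] at hU
    obtain ⟨a, rfl⟩ := hU
    rw [LinearMap.finrank_range_of_inj (blockMap_injective hk hn' a)]
    simp
  · intro S hS hcard
    obtain ⟨U, V, W, hUV, hUW, hVW, rfl⟩ := Finset.card_eq_three.mp hcard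
    simp only [Finset.insert_subset_iff, Finset.singleton_subset_iff, Finset.mem_map,
      Finset.mem_univ, true_and, Function.Embedding.coeFn_mk] at hS
    obtain ⟨⟨a, rfl⟩, ⟨b, rfl⟩, ⟨c, rfl⟩⟩ := hS
    have hinj := coprod_blockMap_injective hk hn' (a := a) (b := b) (c := c)
      (by rintro rfl; exact hUV rfl) (by rintro rfl; exact hVW rfl)
      (by rintro rfl; exact hUW rfl)
    have hrank := LinearMap.finrank_range_of_inj hinj
    rw [LinearMap.range_coprod, LinearMap.range_coprod] at hrank
    rw [Finset.sup_insert, Finset.sup_insert, Finset.sup_singleton]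
    refine le_of_le_of_eq ?_ hrank.symm
    simp only [finrank_prod, finrank_fin_fun]
    omega
end
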